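/- arXiv:1810.05889 — 9 statements merged into one kernel-verified Lean document; each statement's English description precedes it below -/
import Mathlib

section
/- For every integer n ≥ 3 and every integer d ≥ 1, the d-matching polynomial of the n-cycle equals the matching polynomial of the path on d vertices composed with the matching polynomial of the n-cycle; that is, (1/(d!)^n) · Σ_{λ : ℤ/nℤ → S_d} M_{C_{n,λ}}(x) = 𝒫_d(𝒞_n(x)) as polynomials in x over ℚ. -/
open Polynomial


noncomputable section

/-- Number of matchings with exactly `m` edges in a simple graph `G`. -/
def matchingCount {V : Type*} (G : SimpleGraph V) (m : ℕ) : ℕ :=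
  Nat.card {M : Finset (Sym2 V) //
    M.card = m ∧ (∀ e ∈ M, e ∈ G.edgeSet) ∧
    ∀ e ∈ M, ∀ f ∈ M, e ≠ f → ∀ v : V, v ∈ e → v ∉ f}

/-- The matching polynomial of a finite simple graph. -/
def matchingPoly {V : Type*} [Fintype V] (G : SimpleGraph V) : ℚ[X] :=
  ∑ i ∈ Finset.range (Fintype.card V + 1),
    Polynomial.C ((-1 : ℚ) ^ i * (matchingCount G i : ℚ)) * X ^ (Fintype.card V - 2 * i)

/-- Matching polynomial of the path graph on `n` vertices (via the recurrence). -/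
def pathPoly : ℕ → ℚ[X]
  | 0 => 1
  | 1 => X
  | n + 2 => X * pathPoly (n + 1) - pathPoly n

/-- Matching polynomial of the cycle graph on `n` vertices (via the recurrence). -/
def cyclePoly : ℕ → ℚ[X]
  | 0 => 2
  | 1 => X
  | n + 2 => X * cyclePoly (n + 1) - cyclePoly n

/-- The degree-`d` cover of the `n`-cycle determined by the labeling `lam`. -/
def coverGraph (n d : ℕ) (lam : ZMod n → Equiv.Perm (Fin d)) :
    SimpleGraph (ZMod n × Fin d) :=
  SimpleGraph.fromRel fun p q => q.1 = p.1 + 1 ∧ q.2 = lam p.1 p.2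

/-- Number of cycles of length `i` (fixed points counted as 1-cycles) of `σ`. -/
def cycleCount {d : ℕ} (σ : Equiv.Perm (Fin d)) (i : ℕ) : ℕ :=
  (Finset.univ.filter fun x : Fin d => Function.minimalPeriod σ x = i).card / i

/-- The product `λ(n-1) ∘ ⋯ ∘ λ(0)` (applying `λ(0)` first). -/
def cycleProd (n d : ℕ) (lam : ZMod n → Equiv.Perm (Fin d)) : Equiv.Perm (Fin d) :=
  (((List.range n).map fun i => lam (i : ZMod n)).reverse).prod

/-- For a permutation `φ` without orbits of size one or two, the matchings of the graph joining
each `v` to `φ v` correspond to the sets of vertices disjoint from their image under `φ`. -/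
theorem matchingCount_fromRel_perm {V : Type*} [Fintype V] [DecidableEq V] (φ : Equiv.Perm V)
    (h₁ : ∀ v, φ v ≠ v) (h₂ : ∀ v, φ (φ v) ≠ v) (m : ℕ) :
    matchingCount (SimpleGraph.fromRel fun p q => q = φ p) m =
      (Finset.univ.filter fun S : Finset V => (∀ v ∈ S, φ v ∉ S) ∧ S.card = m).card := by
  let e : V ↪ Sym2 V := ⟨fun v => s(v, φ v), fun v w h => by
    rcases Sym2.eq_iff.1 h with h | ⟨h, h'⟩
    · exact h.1
    · exact absurd (by rw [← h, h']) (h₂ w)⟩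
  have he (v : V) : e v = s(v, φ v) := rfl
  rw [matchingCount, ← Fintype.card_subtype, ← Nat.card_eq_fintype_card]
  symm
  refine Nat.card_congr (Equiv.ofBijective (fun S => ⟨S.1.map e, ?_, ?_, ?_⟩) ⟨?_, ?_⟩)
  · rw [Finset.card_map, S.2.2]
  · intro f hf
    obtain ⟨v, -, rfl⟩ := Finset.mem_map.1 hf
    simpa [he] using (h₁ v).symm
  · intro f hf g hg hfg v hvf hvg
    obtain ⟨a, ha, rfl⟩ := Finset.mem_map.1 hf
    obtain ⟨b, hb, rfl⟩ := Finset.mem_map.1 hg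
    have hab : a ≠ b := fun h => hfg (h ▸ rfl)
    rw [he, Sym2.mem_iff] at hvf hvg
    rcases hvf with rfl | rfl <;> rcases hvg with h | h
    · exact hab h
    · exact S.2.1 b hb (h ▸ ha)
    · exact S.2.1 a ha (h ▸ hb)
    · exact hab (φ.injective h)
  · intro S T h
    exact Subtype.ext (Finset.map_injective e (congrArg Subtype.val h))
  · rintro ⟨M, hm, hM, hd⟩
    have hmap : (Finset.univ.filter fun v => e v ∈ M).map e = M := by
      ext f
      simp only [Finset.mem_map, Finset.mem_filter, Finset.mem_univ, true_and]
      refine ⟨by rintro ⟨v, hv, rfl⟩; exact hv, fun hf => ?_⟩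
      have hf' := hM f hf
      induction f using Sym2.ind with
      | _ a b =>
        rw [SimpleGraph.mem_edgeSet, SimpleGraph.fromRel_adj] at hf'
        rcases hf'.2 with rfl | rfl
        · exact ⟨a, hf, rfl⟩
        · exact ⟨b, by rwa [he, Sym2.eq_swap], by rw [he, Sym2.eq_swap]⟩
    refine ⟨⟨Finset.univ.filter fun v => e v ∈ M, fun v hv hv' => ?_, ?_⟩, Subtype.ext hmap⟩
    · simp only [Finset.mem_filter, Finset.mem_univ, true_and] at hv hv'
      exact hd _ hv _ hv' (fun h => h₁ v (e.injective h).symm) (φ v) (Sym2.mem_mk_right _ _)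
        (Sym2.mem_mk_left _ _)
    · rw [← Finset.card_map e, hmap, hm]

theorem matchingPoly_fromRel_perm {V : Type*} [Fintype V] [DecidableEq V] (φ : Equiv.Perm V)
    (h₁ : ∀ v, φ v ≠ v) (h₂ : ∀ v, φ (φ v) ≠ v) :
    matchingPoly (SimpleGraph.fromRel fun p q => q = φ p) =
      ∑ S : Finset V with ∀ v ∈ S, φ v ∉ S,
        C ((-1 : ℚ) ^ S.card) * X ^ (Fintype.card V - 2 * S.card) := by
  rw [matchingPoly, ← Finset.sum_fiberwise_of_maps_to
    (t := Finset.range (Fintype.card V + 1)) (g := Finset.card)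
    (fun S _ => Finset.mem_range_succ_iff.2 S.card_le_univ)]
  refine Finset.sum_congr rfl fun i _ => ?_
  rw [matchingCount_fromRel_perm φ h₁ h₂, Finset.filter_filter,
    Finset.sum_congr rfl (g := fun _ => C ((-1 : ℚ) ^ i) * X ^ (Fintype.card V - 2 * i))
      fun S hS => by rw [(Finset.mem_filter.1 hS).2.2]]
  rw [Finset.sum_const, nsmul_eq_mul, C_mul, C_eq_natCast]
  ring

/-- A finite set of pairs, viewed as the family of its sections. -/
def finsetProdEquiv (α β : Type*) [Fintype α] [Fintype β] [DecidableEq α] [DecidableEq β] :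
    (α → Finset β) ≃ Finset (α × β) where
  toFun S := Finset.univ.filter fun p => p.2 ∈ S p.1
  invFun T a := Finset.univ.filter fun b => (a, b) ∈ T
  left_inv S := by ext; simp
  right_inv T := by ext; simp

theorem card_finsetProdEquiv {α β : Type*} [Fintype α] [Fintype β] [DecidableEq α]
    [DecidableEq β] (S : α → Finset β) : (finsetProdEquiv α β S).card = ∑ a, (S a).card := by
  rw [finsetProdEquiv, Equiv.coe_fn_mk, Finset.card_filter, Fintype.sum_prod_type]
  simp

/-- The permutation of the vertices of a cover of the cycle which advances along the cycle. -/
def coverShift {n d : ℕ} (lam : ZMod n → Equiv.Perm (Fin d)) : Equiv.Perm (ZMod n × Fin d) where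
  toFun p := (p.1 + 1, lam p.1 p.2)
  invFun p := (p.1 - 1, (lam (p.1 - 1)).symm p.2)
  left_inv p := by simp
  right_inv p := by simp

theorem eval_matchingPoly_coverGraph {n d : ℕ} [NeZero n] (hn : 3 ≤ n)
    (lam : ZMod n → Equiv.Perm (Fin d)) (x : ℚ) :
    (matchingPoly (coverGraph n d lam)).eval x =
      ∑ S : ZMod n → Finset (Fin d), ∏ i,
        if Disjoint ((S i).map (lam i).toEmbedding) (S (i + 1)) then
          (-1) ^ (S i).card * x ^ (d - (S i).card - (S (i + 1)).card) else 0 := by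
  have h1 (a : ZMod n) : a + 1 ≠ a := by
    have : Fact (1 < n) := ⟨by omega⟩
    simp
  have h2 (a : ZMod n) : a + 1 + 1 ≠ a := by
    intro h
    have h' : ((2 : ℕ) : ZMod n) = 0 := by
      push_cast; linear_combination h
    rw [ZMod.natCast_eq_zero_iff] at h'
    exact absurd (Nat.le_of_dvd two_pos h') (by omega)
  have hG : coverGraph n d lam = SimpleGraph.fromRel fun p q => q = coverShift lam p := by
    simp only [coverGraph, coverShift, Equiv.coe_fn_mk, Prod.ext_iff]
  have hdisj (S : ZMod n → Finset (Fin d)) :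
      (∀ v ∈ finsetProdEquiv _ _ S, coverShift lam v ∉ finsetProdEquiv _ _ S) ↔
        ∀ i, Disjoint ((S i).map (lam i).toEmbedding) (S (i + 1)) := by
    simp only [finsetProdEquiv, coverShift, Finset.disjoint_left, Equiv.coe_fn_mk,
      Finset.mem_filter, Finset.mem_univ, true_and, Prod.forall, Finset.mem_map,
      forall_exists_index, and_imp, forall_apply_eq_imp_iff₂, Equiv.toEmbedding_apply]
  rw [hG, matchingPoly_fromRel_perm _ (fun v h => h1 v.1 (congrArg Prod.fst h))
    (fun v h => h2 v.1 (congrArg Prod.fst h)), Finset.sum_filter, eval_finsetSum,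
    ← (finsetProdEquiv _ _).sum_comp]
  refine Finset.sum_congr rfl fun S _ => ?_
  rw [if_congr (hdisj S) rfl rfl]
  split_ifs with hS
  · rw [Finset.prod_congr rfl fun i _ => if_pos (hS i), Finset.prod_mul_distrib,
      Finset.prod_pow_eq_pow_sum, Finset.prod_pow_eq_pow_sum, card_finsetProdEquiv]
    simp only [eval_mul, eval_C, eval_pow, eval_X]
    congr 2
    have hle (i : ZMod n) : (S i).card + (S (i + 1)).card ≤ d := by
      rw [← Finset.card_map (lam i).toEmbedding, ← Finset.card_union_of_disjoint (hS i)]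
      exact (Finset.card_le_univ _).trans_eq (Fintype.card_fin d)
    have hsum : ∑ i, (S (i + 1)).card = ∑ i, (S i).card :=
      Equiv.sum_comp (Equiv.addRight (1 : ZMod n)) fun i => (S i).card
    have htot : ∑ i, (d - (S i).card - (S (i + 1)).card) +
        (∑ i, (S i).card + ∑ i, (S (i + 1)).card) = n * d := by
      rw [← Finset.sum_add_distrib, ← Finset.sum_add_distrib,
        Finset.sum_congr rfl (g := fun _ => d) fun i _ => by have := hle i; omega]
      simp
    rw [Fintype.card_prod, ZMod.card, Fintype.card_fin]
    omega
  · push Not at hS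
    obtain ⟨i, hi⟩ := hS
    rw [eval_zero, Finset.prod_eq_zero (Finset.mem_univ i) (if_neg hi)]

theorem exists_perm_map_eq {α : Type*} [Fintype α] [DecidableEq α] {A B : Finset α}
    (h : A.card = B.card) : ∃ τ : Equiv.Perm α, A.map τ.toEmbedding = B := by
  let e : {x // x ∈ A} ≃ {x // x ∈ B} := Finset.equivOfCardEq h
  refine ⟨e.extendSubtype, Finset.eq_of_subset_of_card_le (fun y hy => ?_) (by simp [h])⟩
  obtain ⟨x, hx, rfl⟩ := Finset.mem_map.1 hy
  exact e.extendSubtype_mem x hx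

theorem choose_mul_sum_perm_map {α R : Type*} [Fintype α] [DecidableEq α] [CommSemiring R]
    (A : Finset α) (F : Finset α → R) :
    ((Fintype.card α).choose A.card : R) * ∑ σ : Equiv.Perm α, F (A.map σ.toEmbedding) =
      (Fintype.card α).factorial * ∑ B ∈ Finset.powersetCard A.card Finset.univ, F B := by
  have hconst : ∀ B ∈ Finset.powersetCard A.card (Finset.univ : Finset α),
      ∑ σ : Equiv.Perm α, F (B.map σ.toEmbedding) =
        ∑ σ : Equiv.Perm α, F (A.map σ.toEmbedding) := by
    intro B hB
    obtain ⟨τ, rfl⟩ := exists_perm_map_eq (Finset.mem_powersetCard.1 hB).2.symm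
    rw [← Equiv.sum_comp (Equiv.mulRight τ)
      fun σ : Equiv.Perm α => F (A.map σ.toEmbedding)]
    refine Finset.sum_congr rfl fun σ _ => congrArg F ?_
    rw [Finset.map_map]
    rfl
  have hperm (σ : Equiv.Perm α) :
      ∑ B ∈ Finset.powersetCard A.card Finset.univ, F (B.map σ.toEmbedding) =
        ∑ B ∈ Finset.powersetCard A.card Finset.univ, F B := by
    conv_rhs => rw [← Finset.map_univ_equiv σ, Finset.powersetCard_map, Finset.sum_map]
    rfl
  rw [← Finset.card_univ (α := α), ← Finset.card_powersetCard, ← nsmul_eq_mul,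
    ← Finset.sum_const, ← Finset.sum_congr rfl hconst, Finset.sum_comm,
    Finset.sum_congr rfl fun σ _ => hperm σ, Finset.sum_const, Finset.card_univ,
    Fintype.card_perm, nsmul_eq_mul, Finset.card_univ]

theorem sum_perm_disjoint {d : ℕ} (A B : Finset (Fin d)) :
    ∑ σ : Equiv.Perm (Fin d), (if Disjoint (A.map σ.toEmbedding) B then (1 : ℚ) else 0) =
      d.factorial * ((d - B.card).choose A.card / d.choose A.card) := by
  have h := choose_mul_sum_perm_map (R := ℚ) A fun T => if Disjoint T B then 1 else 0
  have hf : (Finset.powersetCard A.card Finset.univ).filter (fun T => Disjoint T B) =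
      Finset.powersetCard A.card Bᶜ := by
    ext T
    simp [Finset.mem_powersetCard, Finset.subset_compl_iff_disjoint_right, and_comm]
  rw [← Finset.sum_filter (s := Finset.powersetCard _ _), hf, Finset.sum_const,
    nsmul_one, Finset.card_powersetCard, Finset.card_compl, Fintype.card_fin] at h
  have hA : A.card ≤ d := (Finset.card_le_univ _).trans_eq (Fintype.card_fin d)
  have h0 : (d.choose A.card : ℚ) ≠ 0 := by exact_mod_cast (Nat.choose_pos hA).ne'
  field_simp
  linear_combination h

theorem choose_mul_choose_sub_comm (d a b : ℕ) :
    d.choose b * (d - b).choose a = d.choose a * (d - a).choose b := by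
  by_cases h : a + b ≤ d
  · have h1 := Nat.choose_mul (n := d) (k := a + b) (s := a) (by omega)
    have h2 := Nat.choose_mul (n := d) (k := a + b) (s := b) (by omega)
    rw [Nat.add_sub_cancel_left] at h1
    rw [Nat.add_sub_cancel] at h2
    rw [← h1, ← h2, Nat.choose_symm_add]
  · have hz {a b : ℕ} (h : d < a + b) : d.choose b * (d - b).choose a = 0 := by
      by_cases hb : b ≤ d
      · rw [Nat.choose_eq_zero_of_lt (n := d - b) (by omega), mul_zero]
      · rw [Nat.choose_eq_zero_of_lt (by omega), zero_mul]
    rw [hz (not_le.1 h), hz (add_comm a b ▸ not_le.1 h)]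
theorem sum_coeff_mul_pow_eq {R A : Type*} [CommRing R] [Nontrivial R] [CommRing A]
    [Algebra R A] (s t : R) (j k : ℕ)
    (p q : A) :
    ∑ b ∈ Finset.range (j + k + 1),
      algebraMap R A (((X + C t) ^ j * (X + C s) ^ k : R[X]).coeff b) *
        (p ^ b * q ^ (j + k - b)) =
    (p + algebraMap R A t * q) ^ j * (p + algebraMap R A s * q) ^ k := by
  have H (f : R[X]) (d : ℕ) : MvPolynomial.aeval ![p, q] (f.homogenize d) =
      ∑ b ∈ Finset.range (d + 1), algebraMap R A (f.coeff b) * (p ^ b * q ^ (d - b)) := by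
    rw [homogenize, map_sum, Finset.Nat.sum_antidiagonal_eq_sum_range_succ_mk]
    refine Finset.sum_congr rfl fun b _ => ?_
    simp [MvPolynomial.aeval_monomial]
  have hpow (r : R) (m : ℕ) : ((X + C r : R[X]) ^ m).homogenize m =
      (MvPolynomial.X 0 + MvPolynomial.C r * MvPolynomial.X 1) ^ m := by
    have := homogenize_finsetProd (s := Finset.range m) (p := fun _ => (X + C r : R[X]))
      (n := fun _ => 1) (fun _ _ => (natDegree_X_add_C r).le)
    simpa using this
  rw [← H, homogenize_mul _ _ (natDegree_pow_le_of_le _ (natDegree_X_add_C _).le |>.trans (by simp))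
    (natDegree_pow_le_of_le _ (natDegree_X_add_C _).le |>.trans (by simp)), hpow, hpow]
  simp

/-- The action of the transfer matrix of the cycle on binary forms of degree `d`. -/
def symTransfer (d : ℕ) (x : ℚ) : Matrix (Fin (d + 1)) (Fin (d + 1)) ℚ :=
  Matrix.of fun b a => (-1) ^ (b : ℕ) * x ^ (d - b - a : ℕ) * ((d - b : ℕ).choose a : ℚ)

/-- The rows are the left eigenvectors of `symTransfer d (t + s)` when `s * t = 1`. -/
def symEigen (d : ℕ) (s t : ℚ) : Matrix (Fin (d + 1)) (Fin (d + 1)) ℚ :=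
  Matrix.of fun j a => ((X + C t) ^ (j : ℕ) * (X + C s) ^ (d - j : ℕ) : ℚ[X]).coeff a

theorem symEigen_mul_symTransfer (d : ℕ) {s t : ℚ} (h : s * t = 1) :
    symEigen d s t * symTransfer d (t + s) =
      Matrix.diagonal (fun j : Fin (d + 1) => t ^ (j : ℕ) * s ^ (d - j : ℕ)) * symEigen d s t := by
  ext j a
  have hj : (j : ℕ) + (d - j) = d := by omega
  have key := sum_coeff_mul_pow_eq (A := ℚ[X]) s t j (d - j) (-1) (X + C (t + s))
  have e1 : (-1 + C t * (X + C (t + s)) : ℚ[X]) = C t * (X + C t) := by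
    have : (C s * C t : ℚ[X]) = 1 := by rw [← C_mul, h, C_1]
    rw [C_add]; linear_combination this
  have e2 : (-1 + C s * (X + C (t + s)) : ℚ[X]) = C s * (X + C s) := by
    have : (C s * C t : ℚ[X]) = 1 := by rw [← C_mul, h, C_1]
    rw [C_add]; linear_combination this
  rw [hj, algebraMap_eq, e1, e2, Finset.sum_range] at key
  replace key := congrArg (fun f => coeff f (a : ℕ)) key
  have e3 : (C t * (X + C t) : ℚ[X]) ^ (j : ℕ) * (C s * (X + C s)) ^ (d - j : ℕ) =
    C (t ^ (j : ℕ) * s ^ (d - j : ℕ)) * ((X + C t) ^ (j : ℕ) * (X + C s) ^ (d - j : ℕ)) := by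
    simp only [C_mul, C_pow, mul_pow]; ring
  simp only [e3, finsetSum_coeff, coeff_C_mul] at key
  rw [Matrix.diagonal_mul, Matrix.mul_apply]
  simp only [symEigen, symTransfer, Matrix.of_apply]
  rw [← key]
  refine Finset.sum_congr rfl fun b _ => ?_
  rw [show ((-1 : ℚ[X]) ^ (b : ℕ)) = C ((-1) ^ (b : ℕ)) by simp, coeff_C_mul, coeff_X_add_C_pow]
  ring

theorem isUnit_symEigen (d : ℕ) {s t : ℚ} (h : s * t = 1) (ht : 1 < t) :
    IsUnit (symEigen d s t) := by
  have ht0 : t ≠ 0 := by positivity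
  have hs : s = t⁻¹ := eq_inv_of_mul_eq_one_left h
  have hrow := symEigen_mul_symTransfer d h
  rw [← Matrix.linearIndependent_rows_iff_isUnit]
  refine Module.End.eigenvectors_linearIndependent' (Matrix.vecMulLinear (symTransfer d (t + s)))
    (fun j : Fin (d + 1) => t ^ (j : ℕ) * s ^ (d - j : ℕ)) ?_ (symEigen d s t).row fun j => ⟨?_, ?_⟩
  · refine StrictMono.injective fun i j hij => ?_
    have hij' : (i : ℕ) < j := hij
    have hsp : 0 < s := by rw [hs]; positivity
    have hs1 : s ≤ 1 := by rw [hs]; exact inv_le_one_of_one_le₀ ht.le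
    exact mul_lt_mul (pow_lt_pow_right₀ ht hij') (pow_le_pow_of_le_one hsp.le hs1 (by omega))
      (by positivity) (by positivity)
  · rw [Module.End.mem_eigenspace_iff]
    ext a
    have := congrFun (congrFun hrow j) a
    rw [Matrix.diagonal_mul] at this
    simpa [Matrix.mul_apply, Matrix.vecMul, dotProduct] using this
  · intro h0
    have hm : ((X + C t) ^ (j : ℕ) * (X + C s) ^ (d - j : ℕ) : ℚ[X]).Monic :=
      ((monic_X_add_C t).pow _).mul ((monic_X_add_C s).pow _)
    have hd : ((X + C t) ^ (j : ℕ) * (X + C s) ^ (d - j : ℕ) : ℚ[X]).natDegree = d := by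
      rw [((monic_X_add_C t).pow _).natDegree_mul ((monic_X_add_C s).pow _),
        natDegree_pow, natDegree_pow, natDegree_X_add_C, natDegree_X_add_C]
      omega
    have := congrFun h0 (Fin.last d)
    have h1 := hm.coeff_natDegree
    rw [hd] at h1
    simp [symEigen, h1] at this

theorem trace_symTransfer_pow (d n : ℕ) {s t : ℚ} (h : s * t = 1) (ht : 1 < t) :
    (symTransfer d (t + s) ^ n).trace =
      ∑ j ∈ Finset.range (d + 1), (t ^ n) ^ j * (s ^ n) ^ (d - j) := by
  set V := symEigen d s t
  set D := Matrix.diagonal (fun j : Fin (d + 1) => t ^ (j : ℕ) * s ^ (d - j : ℕ))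
  have hV : IsUnit V.det := (Matrix.isUnit_iff_isUnit_det _).1 (isUnit_symEigen d h ht)
  have hsc : SemiconjBy V (symTransfer d (t + s)) D := symEigen_mul_symTransfer d h
  have hn : V * symTransfer d (t + s) ^ n = D ^ n * V := hsc.pow_right n
  have : symTransfer d (t + s) ^ n = V⁻¹ * (D ^ n * V) := by
    rw [← hn, ← Matrix.mul_assoc, Matrix.nonsing_inv_mul _ hV, one_mul]
  rw [this, Matrix.trace_mul_comm, Matrix.mul_assoc, Matrix.mul_nonsing_inv _ hV, mul_one,
    Matrix.diagonal_pow, Matrix.trace_diagonal, Finset.sum_range]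
  refine Finset.sum_congr rfl fun j _ => ?_
  simp only [Pi.pow_apply, mul_pow, ← pow_mul, mul_comm n]

theorem trace_mul_pow_comm {m k R : Type*} [Fintype m] [Fintype k] [DecidableEq m] [DecidableEq k]
    [CommSemiring R] (A : Matrix m k R) (B : Matrix k m R) (n : ℕ) :
    ((A * B) ^ (n + 1)).trace = ((B * A) ^ (n + 1)).trace := by
  have h (n : ℕ) : (A * B) ^ (n + 1) = A * ((B * A) ^ n * B) := by
    induction n with
    | zero => simp
    | succ n ih => rw [pow_succ', ih, pow_succ']; simp only [Matrix.mul_assoc]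
  rw [h, Matrix.trace_mul_comm, pow_succ, Matrix.mul_assoc]

theorem sum_prod_path {ι R : Type*} [Fintype ι] [DecidableEq ι] [CommSemiring R]
    (T : Matrix ι ι R) (k : ℕ) (g : ι → ι → R) :
    ∑ m : Fin (k + 1) → ι, (∏ i : Fin k, T (m i.castSucc) (m i.succ)) * g (m 0) (m (Fin.last k)) =
      ∑ a, ∑ b, (T ^ k) a b * g a b := by
  induction k generalizing g with
  | zero =>
    rw [← (Equiv.funUnique (Fin 1) ι).symm.sum_comp]
    simp [Matrix.one_apply]
  | succ k ih =>
    rw [← (Fin.consEquiv (fun _ : Fin (k + 2) => ι)).sum_comp, Fintype.sum_prod_type]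
    refine Finset.sum_congr rfl fun a _ => ?_
    have := ih (fun c b => T a c * g a b)
    simp only [Fin.consEquiv_apply, Fin.prod_univ_succ, Fin.castSucc_zero, Fin.cons_zero,
      Fin.cons_succ, ← Fin.succ_castSucc, ← Fin.succ_last]
    rw [pow_succ']
    simp only [Matrix.mul_apply, Finset.sum_mul]
    rw [Finset.sum_comm]
    convert this using 1
    · exact Finset.sum_congr rfl fun m _ => by ring
    · exact Finset.sum_congr rfl fun m _ => Finset.sum_congr rfl fun b _ => by ring

theorem sum_prod_cycle {ι R : Type*} [Fintype ι] [DecidableEq ι] [CommSemiring R]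
    (T : Matrix ι ι R) (n : ℕ) [NeZero n] :
    ∑ m : ZMod n → ι, ∏ i, T (m i) (m (i + 1)) = (T ^ n).trace := by
  obtain ⟨k, rfl⟩ : ∃ k, n = k + 1 := ⟨n - 1, (Nat.succ_pred (NeZero.ne n)).symm⟩
  have := sum_prod_path T k fun a b => T b a
  change ∑ m : Fin (k + 1) → ι, ∏ i : Fin (k + 1), T (m i) (m (i + 1)) = _
  simp only [Fin.prod_univ_castSucc, Fin.coeSucc_eq_succ, Fin.last_add_one]
  rw [this, pow_succ]
  simp [Matrix.trace, Matrix.mul_apply]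

theorem eval_cyclePoly (n : ℕ) {s t : ℚ} (h : s * t = 1) :
    (cyclePoly n).eval (t + s) = t ^ n + s ^ n := by
  induction n using Nat.twoStepInduction with
  | zero => norm_num [cyclePoly]
  | one => simp [cyclePoly]
  | more n ih1 ih2 =>
    simp only [cyclePoly, eval_sub, eval_mul, eval_X, ih1, ih2]
    linear_combination (t ^ n + s ^ n) * h

theorem eval_pathPoly (d : ℕ) {a b : ℚ} (h : b * a = 1) :
    (pathPoly d).eval (a + b) = ∑ j ∈ Finset.range (d + 1), a ^ j * b ^ (d - j) := by
  have hs (d : ℕ) : ∑ j ∈ Finset.range (d + 2), a ^ j * b ^ (d + 1 - j) =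
      b * (∑ j ∈ Finset.range (d + 1), a ^ j * b ^ (d - j)) + a ^ (d + 1) := by
    rw [Finset.sum_range_succ, Finset.mul_sum]
    simp only [Nat.sub_self, pow_zero, mul_one, add_left_inj]
    refine Finset.sum_congr rfl fun j hj => ?_
    rw [Finset.mem_range] at hj
    rw [show d + 1 - j = (d - j) + 1 by omega]; ring
  induction d using Nat.twoStepInduction with
  | zero => simp [pathPoly]
  | one => simp [pathPoly, Finset.sum_range_succ, add_comm]
  | more n ih1 ih2 =>
    simp only [pathPoly, eval_sub, eval_mul, eval_X, ih1, ih2]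
    rw [hs (n + 1), hs n]
    linear_combination (∑ j ∈ Finset.range (n + 1), a ^ j * b ^ (n - j)) * h

/-- The averaged weight of a pair of consecutive layers of a cover. -/
def layerWeight (d : ℕ) (x : ℚ) (a b : ℕ) : ℚ :=
  (-1) ^ a * x ^ (d - a - b) * ((d - b).choose a / d.choose a)

theorem trace_layerWeight_pow (n d : ℕ) [NeZero n] (x : ℚ) :
    ((Matrix.of fun A B : Finset (Fin d) => layerWeight d x A.card B.card) ^ n).trace =
      (symTransfer d x ^ n).trace := by
  obtain ⟨k, rfl⟩ : ∃ k, n = k + 1 := ⟨n - 1, (Nat.succ_pred (NeZero.ne n)).symm⟩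
  let P : Matrix (Finset (Fin d)) (Fin (d + 1)) ℚ := .of fun A m => if A.card = m then 1 else 0
  let Q : Matrix (Fin (d + 1)) (Finset (Fin d)) ℚ := .of fun m B => layerWeight d x m B.card
  have hcard (A : Finset (Fin d)) : A.card < d + 1 :=
    Nat.lt_succ_of_le ((Finset.card_le_univ _).trans_eq (Fintype.card_fin d))
  have hPQ : (Matrix.of fun A B : Finset (Fin d) => layerWeight d x A.card B.card) = P * Q := by
    ext A B
    rw [Matrix.mul_apply, Finset.sum_eq_single ⟨A.card, hcard A⟩]
    · simp [P, Q]
    · intro m _ hm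
      have : A.card ≠ m := fun h => hm (Fin.ext h.symm)
      simp [P, this]
    · simp
  have hQP : Q * P = symTransfer d x := by
    ext a b
    have h0 : (d.choose a : ℚ) ≠ 0 := by exact_mod_cast (Nat.choose_pos (Fin.is_le a)).ne'
    have hch : (d.choose b * (d - b : ℕ).choose a : ℚ) = d.choose a * (d - a : ℕ).choose b := by
      exact_mod_cast choose_mul_choose_sub_comm d a b
    have hcount : (Finset.univ.filter fun A : Finset (Fin d) => A.card = b).card =
        d.choose b := by
      rw [← Finset.powerset_univ, ← Finset.powersetCard_eq_filter, Finset.card_powersetCard,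
        Finset.card_univ, Fintype.card_fin]
    have hterm (A : Finset (Fin d)) : Q a A * P A b =
        if A.card = b then layerWeight d x a b else 0 := by
      by_cases h : A.card = b <;> simp [P, Q, h]
    rw [Matrix.mul_apply, Finset.sum_congr rfl fun A _ => hterm A, ← Finset.sum_filter,
      Finset.sum_const, hcount, nsmul_eq_mul, symTransfer, Matrix.of_apply, layerWeight]
    field_simp
    linear_combination x ^ (d - a - b : ℕ) * hch
  rw [hPQ, trace_mul_pow_comm, hQP]

theorem eval_average_matchingPoly_coverGraph {n d : ℕ} [NeZero n] (hn : 3 ≤ n) (x : ℚ) :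
    (C ((d.factorial : ℚ) ^ n)⁻¹ *
      ∑ lam : ZMod n → Equiv.Perm (Fin d), matchingPoly (coverGraph n d lam)).eval x =
        (symTransfer d x ^ n).trace := by
  have hsum (A B : Finset (Fin d)) :
      ∑ σ : Equiv.Perm (Fin d), (if Disjoint (A.map σ.toEmbedding) B then
        (-1) ^ A.card * x ^ (d - A.card - B.card) else 0) =
          d.factorial * layerWeight d x A.card B.card := by
    have h := congrArg (fun r => (-1) ^ A.card * x ^ (d - A.card - B.card) * r)
      (sum_perm_disjoint A B)
    simp only [Finset.mul_sum, mul_ite, mul_one, mul_zero] at h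
    rw [h, layerWeight]
    ring
  have h0 : (d.factorial : ℚ) ^ n ≠ 0 := pow_ne_zero _ (by exact_mod_cast d.factorial_ne_zero)
  rw [← trace_layerWeight_pow, ← sum_prod_cycle, eval_mul, eval_C, eval_finsetSum,
    inv_mul_eq_iff_eq_mul₀ h0, Finset.mul_sum,
    Finset.sum_congr rfl fun lam _ => eval_matchingPoly_coverGraph hn lam x, Finset.sum_comm]
  refine Finset.sum_congr rfl fun S _ => ?_
  rw [← Fintype.prod_sum fun i (σ : Equiv.Perm (Fin d)) =>
    if Disjoint ((S i).map σ.toEmbedding) (S (i + 1)) then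
      (-1) ^ (S i).card * x ^ (d - (S i).card - (S (i + 1)).card) else 0]
  rw [Finset.prod_congr rfl fun i _ => hsum (S i) (S (i + 1)), Finset.prod_mul_distrib,
    Finset.prod_const, Finset.card_univ, ZMod.card]
  rfl

theorem infinite_image_add_inv : ((fun t : ℚ => t + t⁻¹) '' Set.Ioi 1).Infinite := by
  refine (Set.Ioi_infinite (1 : ℚ)).image fun a ha b hb hab => ?_
  rw [Set.mem_Ioi] at ha hb
  have ha0 : a ≠ 0 := by positivity
  have hb0 : b ≠ 0 := by positivity
  field_simp at hab
  have h : (a - b) * (a * b - 1) = 0 := by linear_combination hab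
  rcases mul_eq_zero.1 h with h | h
  · exact sub_eq_zero.1 h
  · nlinarith


/-- The `d`-matching polynomial of the `n`-cycle equals `𝒫_d(𝒞_n(x))`. -/
theorem dMatchingPoly_cycle_eq_pathPoly_comp_cyclePoly
    (n d : ℕ) [NeZero n] (hn : 3 ≤ n) (hd : 1 ≤ d) :
    Polynomial.C (((d.factorial : ℚ)) ^ n)⁻¹ *
        ∑ lam : ZMod n → Equiv.Perm (Fin d), matchingPoly (coverGraph n d lam) =
      (pathPoly d).comp (cyclePoly n) := by
  refine eq_of_infinite_eval_eq _ _ (infinite_image_add_inv.mono ?_)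
  rintro _ ⟨t, ht, rfl⟩
  have h : t⁻¹ * t = 1 := inv_mul_cancel₀ (zero_lt_one.trans ht).ne'
  rw [Set.mem_ofPred_eq, eval_average_matchingPoly_coverGraph hn, trace_symTransfer_pow d n h ht,
    eval_comp, eval_cyclePoly n h, eval_pathPoly d (by rw [← mul_pow, h, one_pow])]

end
end

section
/- For all integers n ≥ 1 and d ≥ 1, one has the polynomial identity (1/d!) · Σ_{σ ∈ S_d} Π_{i=1}^{d} (𝒞_{n·i}(x))^{μ_i(σ)} = 𝒫_d(𝒞_n(x)) over ℚ, where for each permutation σ ∈ S_d, μ_i(σ) denotes the number of cycles of length i (fixed points counted as 1-cycles) in the disjoint cycle decomposition of σ. -/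
open Polynomial


noncomputable section

open Finset in
/-- The `σ`-invariant colourings of `α`, weighted multiplicatively, are counted by the product over
the cycles of `σ` of the corresponding power sums. -/
theorem prod_cycles_eq_sum_invariant {α κ R : Type*} [Fintype α] [DecidableEq α] [Fintype κ]
    [DecidableEq κ] [CommRing R] (σ : Equiv.Perm α)
    [Fintype (Quotient (Equiv.Perm.SameCycle.setoid σ))]
    [DecidableEq (Quotient (Equiv.Perm.SameCycle.setoid σ))] (w : κ → R) :
    ∏ q : Quotient (Equiv.Perm.SameCycle.setoid σ),
        ∑ c, w c ^ #{x : α | (Quotient.mk _ x : Quotient (Equiv.Perm.SameCycle.setoid σ)) = q} =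
      ∑ f : α → κ with f ∘ σ = f, ∏ x, w (f x) := by
  rw [prod_univ_sum, Fintype.piFinset_univ]
  have invariant (f : α → κ) (hf : f ∘ σ = f) {x y : α} (h : σ.SameCycle x y) : f x = f y := by
    obtain ⟨i, _, _, rfl⟩ := h.exists_pow_eq'
    have : ∀ i : ℕ, f ((σ ^ i) x) = f x := by
      intro i
      induction i with
      | zero => simp
      | succ i ih => rw [pow_succ', Equiv.Perm.mul_apply, ← ih]; exact congrFun hf _
    exact (this i).symm
  refine sum_bij' (fun g _ x => g (Quotient.mk _ x))
    (fun f hf => Quotient.lift f fun _ _ => invariant f (mem_filter.1 hf).2)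
    ?_ ?_ ?_ ?_ ?_
  · intro g _
    simp only [mem_filter, mem_univ, true_and]
    funext x
    refine congrArg g (Quotient.sound ?_)
    exact (Equiv.Perm.sameCycle_apply_left).2 (Equiv.Perm.SameCycle.refl σ x)
  · intros; exact mem_univ _
  · intro g _
    funext q
    induction q using Quotient.inductionOn
    rfl
  · intros; rfl
  · intro g _
    have h := prod_fiberwise' univ
      (fun x : α => (Quotient.mk _ x : Quotient (Equiv.Perm.SameCycle.setoid σ))) fun q => w (g q)
    simpa only [prod_const] using h

theorem minimalPeriod_eq_card_sameCycle {α : Type*} [Fintype α] [DecidableEq α]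
    (σ : Equiv.Perm α) (x : α) [DecidablePred fun y => σ.SameCycle y x] :
    Function.minimalPeriod σ x = (Finset.univ.filter fun y => σ.SameCycle y x).card := by
  classical
  have h := MulAction.minimalPeriod_eq_card (a := σ) (b := x)
  rw [← Fintype.card_subtype]
  refine h.trans (Fintype.card_congr (Equiv.subtypeEquivRight fun y => ?_))
  rw [Equiv.Perm.sameCycle_comm]
  constructor
  · rintro ⟨⟨_, i, rfl⟩, rfl⟩
    exact ⟨i, rfl⟩
  · rintro ⟨i, rfl⟩
    exact ⟨⟨_, i, rfl⟩, rfl⟩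

open Finset in
theorem prod_pow_cycleCount {R : Type*} [CommRing R] {d : ℕ} (σ : Equiv.Perm (Fin d))
    [Fintype (Quotient (Equiv.Perm.SameCycle.setoid σ))]
    [DecidableEq (Quotient (Equiv.Perm.SameCycle.setoid σ))] (p : ℕ → R) :
    ∏ i ∈ Icc 1 d, p i ^ cycleCount σ i =
      ∏ q : Quotient (Equiv.Perm.SameCycle.setoid σ),
        p #{x : Fin d | (Quotient.mk _ x : Quotient (Equiv.Perm.SameCycle.setoid σ)) = q} := by
  classical
  set π : Fin d → Quotient (Equiv.Perm.SameCycle.setoid σ) := fun x => Quotient.mk _ x with hπ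
  change _ = ∏ q, p #{x | π x = q}
  have period (x : Fin d) : Function.minimalPeriod σ x = #{y | π y = π x} := by
    rw [minimalPeriod_eq_card_sameCycle]
    congr 1
    ext y
    simp only [mem_filter, mem_univ, true_and]
    exact (Quotient.eq (r := Equiv.Perm.SameCycle.setoid σ)).symm
  have maps : ∀ q ∈ (univ : Finset (Quotient (Equiv.Perm.SameCycle.setoid σ))),
      #{x | π x = q} ∈ Icc 1 d := by
    intro q _
    rw [mem_Icc]
    constructor
    · obtain ⟨x, rfl⟩ := Quotient.exists_rep q
      exact card_pos.2 ⟨x, by simp [hπ]⟩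
    · exact (card_le_univ _).trans_eq (Fintype.card_fin d)
  rw [← prod_fiberwise_of_maps_to' maps p]
  refine prod_congr rfl fun i hi => ?_
  rw [prod_const]
  congr 1
  refine Nat.div_eq_of_eq_mul_left (mem_Icc.1 hi).1 ?_
  rw [card_eq_sum_card_fiberwise (f := π) (t := {q | #{x | π x = q} = i})]
  · refine sum_const_nat fun q hq => ?_
    rw [mem_filter] at hq
    rw [← hq.2, filter_filter]
    congr 1
    ext x
    simp only [mem_filter, mem_univ, true_and, period]
    constructor
    · exact fun h => h.2
    · rintro rfl
      exact ⟨rfl, rfl⟩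
  · intro x hx
    simpa [period] using hx

open Finset in
/-- The cycle index of the symmetric group on `d` letters, evaluated at the power sums of two
variables, is the complete homogeneous symmetric polynomial of degree `d`. -/
theorem sum_perm_prod_power_sum {R : Type*} [CommRing R] (u v : R) (d : ℕ) :
    ∑ σ : Equiv.Perm (Fin d), ∏ i ∈ Icc 1 d, (u ^ i + v ^ i) ^ cycleCount σ i =
      d.factorial * ∑ k ∈ range (d + 1), u ^ k * v ^ (d - k) := by
  classical
  let w : Bool → R := fun b => cond b u v
  have cycles (σ : Equiv.Perm (Fin d)) :
      ∏ i ∈ Icc 1 d, (u ^ i + v ^ i) ^ cycleCount σ i =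
        ∑ f : Fin d → Bool, if f ∘ σ = f then ∏ x, w (f x) else 0 := by
    rw [prod_pow_cycleCount σ fun i => u ^ i + v ^ i, ← sum_filter,
      ← prod_cycles_eq_sum_invariant σ w]
    simp [w]
  have card_false (f : Fin d → Bool) : #{x | f x = false} = d - #{x | f x = true} := by
    have h := card_filter_add_card_filter_not (s := (univ : Finset (Fin d))) (fun x => f x = true)
    simp only [Bool.not_eq_true, card_univ, Fintype.card_fin] at h
    omega
  have weight (f : Fin d → Bool) :
      (∑ σ : Equiv.Perm (Fin d), if f ∘ σ = f then ∏ x, w (f x) else 0) =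
        (#{x | f x = true}).factorial * (d - #{x | f x = true}).factorial *
          (u ^ #{x | f x = true} * v ^ (d - #{x | f x = true})) := by
    rw [← sum_filter, sum_const, ← Fintype.card_subtype, DomMulAct.stabilizer_card,
      ← prod_fiberwise' univ f w]
    simp only [prod_const, Fintype.card_subtype, Fintype.prod_bool, card_false, w, cond_true,
      cond_false, nsmul_eq_mul, Nat.cast_mul]
  have reindex (F : ℕ → R) :
      ∑ f : Fin d → Bool, F #{x | f x = true} = ∑ k ∈ range (d + 1), d.choose k • F k := by
    have h := sum_powerset_apply_card F (x := (univ : Finset (Fin d)))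
    rw [powerset_univ, card_univ, Fintype.card_fin] at h
    rw [← h]
    exact sum_bij' (fun f _ => univ.filter fun x => f x = true) (fun s _ x => decide (x ∈ s))
      (by simp) (by simp) (by intros; ext; simp) (by intros; ext; simp) (by simp)
  simp_rw [cycles]
  rw [sum_comm]
  simp_rw [weight]
  rw [reindex fun k => k.factorial * (d - k).factorial * (u ^ k * v ^ (d - k)), mul_sum]
  refine sum_congr rfl fun k hk => ?_
  rw [← Nat.choose_mul_factorial_mul_factorial (Nat.lt_succ_iff.1 (mem_range.1 hk)), nsmul_eq_mul]
  push_cast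
  ring

theorem aeval_cyclePoly {R : Type*} [CommRing R] [Algebra ℚ R] {u v : R} (h : u * v = 1) :
    ∀ m : ℕ, aeval (u + v) (cyclePoly m) = u ^ m + v ^ m
  | 0 => by rw [cyclePoly, map_ofNat, pow_zero, pow_zero, one_add_one_eq_two]
  | 1 => by simp [cyclePoly]
  | m + 2 => by
    rw [cyclePoly, map_sub, map_mul, aeval_X, aeval_cyclePoly h (m + 1), aeval_cyclePoly h m]
    linear_combination (u ^ m + v ^ m) * h

theorem aeval_pathPoly {R : Type*} [CommRing R] [Algebra ℚ R] {u v : R} (h : u * v = 1) :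
    ∀ d : ℕ, aeval (u + v) (pathPoly d) = ∑ k ∈ Finset.range (d + 1), u ^ k * v ^ (d - k)
  | 0 => by simp [pathPoly]
  | 1 => by simp [pathPoly, Finset.sum_range_succ, add_comm]
  | d + 2 => by
    have step (m : ℕ) : ∑ k ∈ Finset.range (m + 2), u ^ k * v ^ (m + 1 - k) =
        u ^ (m + 1) + v * ∑ k ∈ Finset.range (m + 1), u ^ k * v ^ (m - k) := by
      have := Commute.geom_sum₂_succ_eq (Commute.all u v) (n := m + 1)
      simpa using this
    rw [pathPoly, map_sub, map_mul, aeval_X, aeval_pathPoly h (d + 1), aeval_pathPoly h d,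
      step (d + 1), step d]
    linear_combination (∑ k ∈ Finset.range (d + 1), u ^ k * v ^ (d - k)) * h

/-- `(1/d!) · Σ_{σ ∈ S_d} Π_{i=1}^{d} 𝒞_{n·i}(x)^{μ_i(σ)} = 𝒫_d(𝒞_n(x))`. -/
theorem avg_cycleType_prod_cyclePoly_eq_pathPoly_comp (n d : ℕ) (hn : 1 ≤ n) (hd : 1 ≤ d) :
    Polynomial.C ((d.factorial : ℚ))⁻¹ *
        ∑ σ : Equiv.Perm (Fin d),
          ∏ i ∈ Finset.Icc 1 d, cyclePoly (n * i) ^ cycleCount σ i =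
      (pathPoly d).comp (cyclePoly n) := by
  have scaled : ∑ σ : Equiv.Perm (Fin d),
        ∏ i ∈ Finset.Icc 1 d, cyclePoly (n * i) ^ cycleCount σ i =
      Polynomial.C (d.factorial : ℚ) * (pathPoly d).comp (cyclePoly n) := by
    apply Polynomial.map_injective (algebraMap ℚ ℂ) (algebraMap ℚ ℂ).injective
    refine Polynomial.funext fun z => ?_
    rw [eval_map_algebraMap, eval_map_algebraMap]
    obtain ⟨u, hu⟩ := IsAlgClosed.exists_eval₂_eq_zero_of_injective (RingHom.id ℂ)
      Function.injective_id (X ^ 2 - C z * X + 1) (by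
        have : (X ^ 2 - C z * X + 1 : ℂ[X]).degree = 2 := by compute_degree!
        rw [this]; decide)
    have huv : u * (z - u) = 1 := by
      simp at hu
      linear_combination -hu
    obtain ⟨v, rfl⟩ : ∃ v, z = u + v := ⟨z - u, by ring⟩
    rw [add_sub_cancel_left] at huv
    have huvn : u ^ n * v ^ n = 1 := by rw [← mul_pow, huv, one_pow]
    simp only [map_sum, map_prod, map_pow, map_mul, aeval_comp, aeval_cyclePoly huv,
      aeval_pathPoly huvn, pow_mul, sum_perm_prod_power_sum, map_natCast]
  rw [scaled, ← mul_assoc, ← C_mul, inv_mul_cancel₀ (by exact_mod_cast d.factorial_ne_zero), C_1,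
    one_mul]

end
end

section
/- For all integers n ≥ 1 and d ≥ 1, the matching polynomials of paths and cycles satisfy 𝒫_{dn+n−1}(x) = 𝒫_d(𝒞_n(x)) · 𝒫_{n−1}(x) as polynomials over ℚ. -/
open Polynomial


noncomputable section

theorem pathPoly_add_two (n : ℕ) : pathPoly (n + 2) = X * pathPoly (n + 1) - pathPoly n := rfl

theorem cyclePoly_add_two (n : ℕ) : cyclePoly (n + 2) = X * cyclePoly (n + 1) - cyclePoly n := rfl

theorem cyclePoly_mul_pathPoly (n k : ℕ) :
    cyclePoly n * pathPoly (k + n) = pathPoly (k + 2 * n) + pathPoly k := by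
  induction n using Nat.twoStepInduction generalizing k with
  | zero => simp [cyclePoly, two_mul]
  | one => simp [cyclePoly, pathPoly]
  | more n ih₀ ih₁ =>
    have h₀ := ih₀ (k + 2)
    have h₁ := ih₁ (k + 1)
    rw [show k + 2 + n = k + (n + 2) by ring, show k + 2 + 2 * n = k + 2 * n + 2 by ring] at h₀
    rw [show k + 1 + (n + 1) = k + (n + 2) by ring,
      show k + 1 + 2 * (n + 1) = k + 2 * n + 2 + 1 by ring] at h₁
    rw [show k + 2 * (n + 2) = k + 2 * n + 2 + 2 by ring, cyclePoly_add_two,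
      pathPoly_add_two (k + 2 * n + 2)]
    linear_combination X * h₁ - h₀ - pathPoly_add_two k

theorem cyclePoly_succ_mul_pathPoly (n : ℕ) :
    cyclePoly (n + 1) * pathPoly n = pathPoly (2 * n + 1) := by
  match n with
  | 0 => simp [cyclePoly, pathPoly]
  | n + 1 =>
    have h₀ := cyclePoly_mul_pathPoly n 1
    have h₁ := cyclePoly_mul_pathPoly (n + 1) 0
    rw [add_comm 1 n, add_comm 1 (2 * n), show pathPoly 1 = X from rfl] at h₀
    rw [zero_add, zero_add, show 2 * (n + 1) = 2 * n + 1 + 1 by ring,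
      show pathPoly 0 = 1 from rfl] at h₁
    rw [show 2 * (n + 1) + 1 = 2 * n + 1 + 2 by ring, pathPoly_add_two (2 * n + 1),
      cyclePoly_add_two]
    linear_combination X * h₁ - h₀

theorem pathPoly_mul_succ_add (m d : ℕ) :
    pathPoly (d * (m + 1) + m) = (pathPoly d).comp (cyclePoly (m + 1)) * pathPoly m := by
  induction d using Nat.twoStepInduction with
  | zero => simp [pathPoly]
  | one =>
    rw [show 1 * (m + 1) + m = 2 * m + 1 by ring, ← cyclePoly_succ_mul_pathPoly,
      show pathPoly 1 = X from rfl, X_comp]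
  | more d ih₀ ih₁ =>
    have h := cyclePoly_mul_pathPoly (m + 1) (d * (m + 1) + m)
    rw [show d * (m + 1) + m + (m + 1) = (d + 1) * (m + 1) + m by ring,
      show d * (m + 1) + m + 2 * (m + 1) = (d + 2) * (m + 1) + m by ring, ih₀, ih₁] at h
    rw [pathPoly_add_two d, sub_comp, mul_comp, X_comp]
    linear_combination -h

/-- `𝒫_{dn+n−1}(x) = 𝒫_d(𝒞_n(x)) · 𝒫_{n−1}(x)`. -/
theorem pathPoly_eq_pathPoly_comp_cyclePoly_mul (n d : ℕ) (hn : 1 ≤ n) (hd : 1 ≤ d) :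
    pathPoly (d * n + n - 1) = (pathPoly d).comp (cyclePoly n) * pathPoly (n - 1) := by
  obtain ⟨m, rfl⟩ := Nat.exists_eq_add_of_le' hn
  exact pathPoly_mul_succ_add m d

end
end

section
/- For all integers d ≥ 1 and m ≥ 0, one has d! · a(P_d, m) = Σ_{σ ∈ S_d} a(G_σ, m), where a(P_d, m) is the number of m-edge matchings of the path on d vertices and a(G_σ, m) is the number of m-edge matchings of the functional graph of the permutation σ. -/
open Polynomial


noncomputable section

/-- Number of `m`-edge matchings of the functional graph `G_σ` of a permutation `σ`:
sets `S` of size `m` of non-fixed points with the pairs `{s, σ s}` pairwise disjoint. -/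
def permMatchingCount {d : ℕ} (σ : Equiv.Perm (Fin d)) (m : ℕ) : ℕ :=
  Nat.card {S : Finset (Fin d) //
    S.card = m ∧ (∀ s ∈ S, σ s ≠ s) ∧
    ∀ s ∈ S, ∀ t ∈ S, s ≠ t → ({s, σ s} : Finset (Fin d)) ∩ {t, σ t} = ∅}

open Finset in
/-- The number of `m`-element subsets of `{0, …, n - 1}` without two consecutive elements. -/
theorem card_powersetCard_filter_no_consecutive (n m : ℕ) :
    #{A ∈ powersetCard m (range n) | ∀ a ∈ A, a + 1 ∉ A} = (n + 1 - m).choose m := by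
  induction n using Nat.twoStepInduction generalizing m with
  | zero =>
    rcases m with _ | m
    · decide
    · simp
  | one =>
    rcases m with _ | _ | m
    · decide
    · decide
    · rw [powersetCard_eq_empty.2 (by simp)]
      simp
  | more n ih₀ ih₁ =>
    rcases m with _ | m
    · simp [filter_singleton]
    · have h : (n + 2 + 1 - (m + 1)).choose (m + 1) =
          (n + 1 + 1 - (m + 1)).choose (m + 1) + (n + 1 - m).choose m := by
        rcases le_or_gt m (n + 1) with hm | hm
        · obtain ⟨k, hk⟩ := Nat.exists_eq_add_of_le hm
          rw [show n + 2 + 1 - (m + 1) = k + 1 by omega, show n + 1 + 1 - (m + 1) = k by omega,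
            show n + 1 - m = k by omega, Nat.choose_succ_succ, add_comm]
        · rw [Nat.choose_eq_zero_of_lt (by omega), Nat.choose_eq_zero_of_lt (by omega),
            Nat.choose_eq_zero_of_lt (by omega)]
      rw [h, ← ih₁, ← ih₀, ← card_filter_add_card_filter_not (fun A => n + 1 ∉ A)]
      congr 1
      · congr 1
        ext A
        simp only [mem_filter, mem_powersetCard, subset_iff, mem_range]
        constructor
        · rintro ⟨⟨⟨hs, hc⟩, hA⟩, hn⟩
          refine ⟨⟨fun x hx => ?_, hc⟩, hA⟩
          have := hs hx
          have : x ≠ n + 1 := fun h => hn (h ▸ hx)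
          omega
        · rintro ⟨⟨hs, hc⟩, hA⟩
          exact ⟨⟨⟨fun x hx => (hs hx).trans (by omega), hc⟩, hA⟩,
            fun hx => absurd (hs hx) (by omega)⟩
      · refine card_bij' (fun A _ => A.erase (n + 1)) (fun A _ => insert (n + 1) A) ?_ ?_ ?_ ?_
        · intro A hA
          simp only [mem_filter, mem_powersetCard, subset_iff, mem_range, not_not] at hA ⊢
          obtain ⟨⟨⟨hs, hc⟩, hA⟩, hn⟩ := hA
          refine ⟨⟨fun x hx => ?_, by rw [card_erase_of_mem hn, hc]; rfl⟩, fun a ha => ?_⟩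
          · have h₁ := hs (mem_of_mem_erase hx)
            have h₂ := ne_of_mem_erase hx
            have h₃ : x ≠ n := fun h => hA x (mem_of_mem_erase hx) (h ▸ hn)
            omega
          · exact fun h => hA a (mem_of_mem_erase ha) (mem_of_mem_erase h)
        · intro A hA
          simp only [mem_filter, mem_powersetCard, subset_iff, mem_range, not_not] at hA ⊢
          obtain ⟨⟨hs, hc⟩, hA⟩ := hA
          have hn : n + 1 ∉ A := fun h => absurd (hs h) (by omega)
          refine ⟨⟨⟨fun x hx => ?_, by rw [card_insert_of_notMem hn, hc]⟩, fun a ha h => ?_⟩,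
            mem_insert_self _ _⟩
          · rcases mem_insert.1 hx with rfl | hx
            · omega
            · exact (hs hx).trans (by omega)
          · rcases mem_insert.1 ha with rfl | ha <;> rcases mem_insert.1 h with h | h
            · omega
            · exact absurd (hs h) (by omega)
            · have := hs ha
              omega
            · exact hA a ha h
        · intro A hA
          exact insert_erase (by simpa using (mem_filter.1 hA).2)
        · intro A hA
          refine erase_insert fun h => ?_
          have := mem_range.1 ((mem_powersetCard.1 (mem_filter.1 hA).1).1 h)
          omega

/-- The `i`-th edge of the path on the vertices `0, …, n`. -/
def pathEdge (n i : ℕ) : Sym2 (Fin (n + 1)) :=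
  s(Fin.ofNat (n + 1) i, Fin.ofNat (n + 1) (i + 1))

theorem mem_pathEdge {n i : ℕ} (hi : i < n) (v : Fin (n + 1)) :
    v ∈ pathEdge n i ↔ (v : ℕ) = i ∨ (v : ℕ) = i + 1 := by
  simp [pathEdge, Sym2.mem_iff, Fin.ext_iff, Nat.mod_eq_of_lt (show i < n + 1 by omega),
    Nat.mod_eq_of_lt (show i + 1 < n + 1 by omega)]

theorem pathEdge_injOn (n : ℕ) : Set.InjOn (pathEdge n) (Finset.range n) := by
  intro i hi j hj h
  simp only [Finset.coe_range, Set.mem_Iio] at hi hj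
  have h₁ := (mem_pathEdge hj ⟨i, by omega⟩).1 (h ▸ (mem_pathEdge hi _).2 (Or.inl rfl))
  have h₂ := (mem_pathEdge hi ⟨j, by omega⟩).1 (h ▸ (mem_pathEdge hj _).2 (Or.inl rfl))
  simp only at h₁ h₂
  omega

theorem mem_edgeSet_pathGraph_iff {n : ℕ} (e : Sym2 (Fin (n + 1))) :
    e ∈ (SimpleGraph.pathGraph (n + 1)).edgeSet ↔ ∃ i < n, pathEdge n i = e := by
  induction e with
  | _ u v =>
    rw [SimpleGraph.mem_edgeSet, SimpleGraph.pathGraph_adj]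
    constructor
    · rintro (h | h)
      · refine ⟨u, by omega, ?_⟩
        simp [pathEdge, h]
      · refine ⟨v, by omega, ?_⟩
        simp [pathEdge, h, Sym2.eq_swap]
    · rintro ⟨i, hi, h⟩
      have hu := (mem_pathEdge hi u).1 (h ▸ Sym2.mem_mk_left u v)
      have hv := (mem_pathEdge hi v).1 (h ▸ Sym2.mem_mk_right u v)
      have h₁ := (mem_pathEdge hi ⟨i, by omega⟩).2 (Or.inl rfl)
      have h₂ := (mem_pathEdge hi ⟨i + 1, by omega⟩).2 (Or.inr rfl)
      rw [h, Sym2.mem_iff, Fin.ext_iff, Fin.ext_iff] at h₁ h₂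
      simp only at h₁ h₂
      omega

open Finset in
theorem matchingCount_pathGraph (n m : ℕ) :
    matchingCount (SimpleGraph.pathGraph (n + 1)) m = (n + 1 - m).choose m := by
  classical
  rw [← card_powersetCard_filter_no_consecutive, matchingCount, Nat.card_eq_fintype_card,
    Fintype.card_subtype]
  symm
  refine card_bij (fun A _ => A.image (pathEdge n)) ?_ ?_ ?_
  · intro A hA
    simp only [mem_filter, mem_powersetCard, mem_univ, true_and] at hA ⊢
    obtain ⟨⟨hs, hc⟩, hA⟩ := hA
    refine ⟨?_, ?_, ?_⟩
    · rw [card_image_of_injOn ((pathEdge_injOn n).mono (by exact_mod_cast hs)), hc]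
    · simp only [mem_image, forall_exists_index, and_imp]
      rintro e i hi rfl
      exact (mem_edgeSet_pathGraph_iff _).2 ⟨i, mem_range.1 (hs hi), rfl⟩
    · simp only [mem_image, forall_exists_index, and_imp]
      rintro e i hi rfl f j hj rfl hne v hv hv'
      rw [mem_pathEdge (mem_range.1 (hs hi))] at hv
      rw [mem_pathEdge (mem_range.1 (hs hj))] at hv'
      have hij : i ≠ j := fun h => hne (h ▸ rfl)
      have h₁ : j ≠ i + 1 := fun h => hA i hi (h ▸ hj)
      have h₂ : i ≠ j + 1 := fun h => hA j hj (h ▸ hi)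
      omega
  · intro A hA B hB h
    have hA' := (mem_powersetCard.1 (mem_filter.1 hA).1).1
    have hB' := (mem_powersetCard.1 (mem_filter.1 hB).1).1
    have h' : pathEdge n '' A = pathEdge n '' B := by exact_mod_cast congrArg SetLike.coe h
    exact_mod_cast ((pathEdge_injOn n).image_eq_image_iff (by exact_mod_cast hA')
      (by exact_mod_cast hB')).1 h'
  · intro M hM
    simp only [mem_filter, mem_univ, true_and] at hM
    obtain ⟨hc, hE, hM⟩ := hM
    have himage : ({i ∈ range n | pathEdge n i ∈ M} : Finset ℕ).image (pathEdge n) = M := by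
      ext e
      simp only [mem_image, mem_filter, mem_range]
      constructor
      · rintro ⟨i, ⟨_, hi⟩, rfl⟩
        exact hi
      · intro he
        obtain ⟨i, hi, rfl⟩ := (mem_edgeSet_pathGraph_iff e).1 (hE e he)
        exact ⟨i, ⟨hi, he⟩, rfl⟩
    refine ⟨{i ∈ range n | pathEdge n i ∈ M}, ?_, himage⟩
    simp only [mem_filter, mem_powersetCard, mem_range, filter_subset, true_and]
    refine ⟨?_, ?_⟩
    · rw [← hc, ← card_image_of_injOn ((pathEdge_injOn n).mono 
        (coe_subset.2 (filter_subset _ _))), himage]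
    · rintro i ⟨hi, hi'⟩ ⟨hj, hj'⟩
      refine hM _ hi' _ hj' (fun h => ?_) ⟨i + 1, by omega⟩
        ((mem_pathEdge hi _).2 (Or.inr rfl)) ((mem_pathEdge hj _).2 (Or.inl rfl))
      have := pathEdge_injOn n (by simpa using hi) (by simpa using hj) h
      omega

section

open Finset

variable {α : Type*} [DecidableEq α] [Fintype α]

theorem Finset.exists_perm_image_eq {S T : Finset α} (h : #S = #T) :
    ∃ σ : Equiv.Perm α, S.image σ = T := by
  refine ⟨(Finset.equivOfCardEq h).extendSubtype, eq_of_subset_of_card_le ?_ ?_⟩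
  · intro x hx
    obtain ⟨s, hs, rfl⟩ := mem_image.1 hx
    exact Equiv.extendSubtype_mem _ s hs
  · rw [card_image_of_injective _ (Equiv.injective _), h]

theorem card_perm_image_eq_mul_choose {m : ℕ} {S T : Finset α} (hS : #S = m) (hT : #T = m) :
    (Fintype.card α).choose m * #{σ : Equiv.Perm α | S.image σ = T} =
      (Fintype.card α).factorial := by
  have hmaps : Set.MapsTo (fun σ : Equiv.Perm α => S.image σ)
      (univ : Finset (Equiv.Perm α)) (powersetCard m (univ : Finset α)) := by
    intro σ _
    simp [card_image_of_injective _ σ.injective, hS]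
  rw [← Fintype.card_perm, ← card_univ (α := Equiv.Perm α), card_eq_sum_card_fiberwise hmaps,
    ← card_univ (α := α), ← card_powersetCard, ← smul_eq_mul, ← sum_const]
  refine sum_congr rfl fun T' hT' => ?_
  obtain ⟨τ, rfl⟩ := exists_perm_image_eq (hT.trans (mem_powersetCard.1 hT').2.symm)
  refine card_equiv (Equiv.mulLeft τ) fun σ => ?_
  simp only [mem_filter, mem_univ, true_and, Equiv.coe_mulLeft, Equiv.Perm.coe_mul]
  rw [← image_image, (image_injective τ.injective).eq_iff]

theorem choose_mul_card_perm_disjoint_image {m : ℕ} {S : Finset α} (hS : #S = m) :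
    (Fintype.card α).choose m * #{σ : Equiv.Perm α | Disjoint (S.image σ) S} =
      (Fintype.card α - m).choose m * (Fintype.card α).factorial := by
  have hmaps : Set.MapsTo (fun σ : Equiv.Perm α => S.image σ)
      ({σ : Equiv.Perm α | Disjoint (S.image σ) S} : Finset _) (powersetCard m Sᶜ) := by
    intro σ hσ
    simp only [coe_filter, mem_univ, true_and, Set.mem_ofPred_eq] at hσ
    simp only [SetLike.mem_coe, mem_powersetCard, card_image_of_injective _ σ.injective, hS,
      and_true]
    exact subset_compl_iff_disjoint_right.2 hσ
  rw [card_eq_sum_card_fiberwise hmaps, mul_sum, ← hS, ← card_compl, ← card_powersetCard,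
    ← smul_eq_mul (a := #(powersetCard _ _)), ← sum_const]
  refine sum_congr rfl fun T hT => ?_
  obtain ⟨hT, hT'⟩ := mem_powersetCard.1 hT
  rw [← card_perm_image_eq_mul_choose rfl hT', filter_filter]
  congr 2
  ext σ
  simp only [mem_filter, mem_univ, true_and, and_iff_right_iff_imp]
  rintro rfl
  exact subset_compl_iff_disjoint_right.1 hT

theorem sum_card_disjoint_image (m : ℕ) :
    ∑ σ : Equiv.Perm α, #{S ∈ powersetCard m (univ : Finset α) | Disjoint (S.image σ) S} =
      (Fintype.card α - m).choose m * (Fintype.card α).factorial := by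
  have hcomm := sum_card_bipartiteAbove_eq_sum_card_bipartiteBelow
    (s := (univ : Finset (Equiv.Perm α))) (t := powersetCard m (univ : Finset α))
    (fun σ S => Disjoint (S.image σ) S)
  simp only [bipartiteAbove, bipartiteBelow] at hcomm
  rw [hcomm]
  rcases lt_or_ge (Fintype.card α) m with hm | hm
  · rw [powersetCard_eq_empty.2 (by simpa using hm), sum_empty,
      Nat.choose_eq_zero_of_lt (by omega), zero_mul]
  · refine Nat.eq_of_mul_eq_mul_left (Nat.choose_pos hm) ?_
    rw [mul_sum, sum_congr rfl fun S hS =>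
      choose_mul_card_perm_disjoint_image (mem_powersetCard.1 hS).2]
    simp

end

open Finset in
theorem permMatchingCount_eq_card {d : ℕ} (σ : Equiv.Perm (Fin d)) (m : ℕ) :
    permMatchingCount σ m =
      #{S ∈ powersetCard m (univ : Finset (Fin d)) | Disjoint (S.image σ) S} := by
  classical
  rw [permMatchingCount, Nat.card_eq_fintype_card, Fintype.card_subtype]
  congr 1
  ext S
  simp only [mem_filter, mem_univ, true_and, mem_powersetCard, subset_univ]
  refine and_congr_right fun _ => ?_
  simp only [← disjoint_iff_inter_eq_empty, disjoint_left, mem_insert, mem_singleton, mem_image,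
    forall_exists_index, and_imp]
  constructor
  · rintro ⟨hfix, hdisj⟩ _ s hs rfl ht
    exact hdisj s hs (σ s) ht (hfix s hs).symm (Or.inr rfl) (Or.inl rfl)
  · intro h
    refine ⟨fun s hs hfix => h s hs rfl (hfix.symm ▸ hs), ?_⟩
    rintro s hs t ht hst x (rfl | rfl) (hx | hx)
    · exact hst hx
    · exact h t ht rfl (hx ▸ hs)
    · exact h s hs rfl (hx.symm ▸ ht)
    · exact hst (σ.injective hx)

/-- `d! · a(P_d, m) = Σ_{σ ∈ S_d} a(G_σ, m)`. -/
theorem factorial_mul_pathMatchingCount (d m : ℕ) (hd : 1 ≤ d) :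
    d.factorial * matchingCount (SimpleGraph.pathGraph d) m =
      ∑ σ : Equiv.Perm (Fin d), permMatchingCount σ m := by
  obtain ⟨n, rfl⟩ := Nat.exists_eq_add_of_le' hd
  simp_rw [permMatchingCount_eq_card]
  rw [matchingCount_pathGraph, sum_card_disjoint_image, Fintype.card_fin, mul_comm]

end
end

section
/- For all integers d ≥ 1 and m with 0 ≤ 2m ≤ d, one has 2^m · (d−m)! · a(K_d, m) = Σ_{σ ∈ S_d} a(G_σ, m), where a(K_d, m) is the number of m-edge matchings of the complete graph on d vertices and a(G_σ, m) is the number of m-edge matchings of the functional graph of the permutation σ. -/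
open Polynomial


noncomputable section

/-- A set of ordered pairs forming a matching of the complete graph together with an orientation
of every edge. -/
def IsOrientedMatching {V : Type*} (D : Finset (V × V)) : Prop :=
  (∀ p ∈ D, p.1 ≠ p.2) ∧
    ∀ p ∈ D, ∀ q ∈ D, p ≠ q → p.1 ≠ q.1 ∧ p.1 ≠ q.2 ∧ p.2 ≠ q.1 ∧ p.2 ≠ q.2

/-- Orient the edge `e` as its chosen representative if `e ∈ T`, and the other way otherwise. -/
def orientEdge {V : Type*} [DecidableEq V] (T : Finset (Sym2 V)) (e : Sym2 V) : V × V :=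
  if e ∈ T then Quot.out e else (Quot.out e).swap

theorem mk_orientEdge {V : Type*} [DecidableEq V] (T : Finset (Sym2 V)) (e : Sym2 V) :
    Sym2.mk (orientEdge T e).1 (orientEdge T e).2 = e := by
  have h : Sym2.mk (Quot.out e).1 (Quot.out e).2 = e := Quot.out_eq e
  unfold orientEdge
  split_ifs
  · exact h
  · rw [Prod.fst_swap, Prod.snd_swap, Sym2.eq_swap]
    exact h

theorem orientEdge_mk {V : Type*} [DecidableEq V] (T : Finset (Sym2 V)) (p : V × V)
    (h : s(p.1, p.2) ∈ T ↔ Quot.out s(p.1, p.2) = p) : orientEdge T s(p.1, p.2) = p := by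
  have h' : Sym2.mk (Quot.out s(p.1, p.2)).1 (Quot.out s(p.1, p.2)).2 = s(p.1, p.2) :=
    Quot.out_eq _
  unfold orientEdge
  split_ifs with hT
  · exact h.1 hT
  · have hne : Quot.out s(p.1, p.2) ≠ p := fun hp => hT (h.2 hp)
    rw [Sym2.eq_iff] at h'
    rcases h' with h' | h'
    · exact absurd (Prod.ext h'.1 h'.2) hne
    · exact Prod.ext h'.2 h'.1

theorem IsOrientedMatching.injOn_mk {V : Type*} {D : Finset (V × V)} (hD : IsOrientedMatching D) :
    Set.InjOn (fun p : V × V => s(p.1, p.2)) D := by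
  intro p hp q hq h
  by_contra hpq
  have := hD.2 p hp q hq hpq
  simp only [Sym2.eq_iff] at h
  tauto

open Classical in
theorem card_orientedMatching {V : Type*} [Fintype V] (m : ℕ) :
    (Finset.univ.filter fun D : Finset (V × V) => D.card = m ∧ IsOrientedMatching D).card =
      2 ^ m * matchingCount (⊤ : SimpleGraph V) m := by
  set A := Finset.univ.filter fun M : Finset (Sym2 V) =>
    M.card = m ∧ (∀ e ∈ M, e ∈ (⊤ : SimpleGraph V).edgeSet) ∧
    ∀ e ∈ M, ∀ f ∈ M, e ≠ f → ∀ v : V, v ∈ e → v ∉ f with hA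
  have hcount : matchingCount (⊤ : SimpleGraph V) m = A.card := by
    rw [matchingCount, Nat.card_eq_fintype_card, Fintype.card_subtype]
  have hsigma : (A.sigma fun M => M.powerset).card = 2 ^ m * A.card := by
    rw [Finset.card_sigma, Finset.sum_const_nat (m := 2 ^ m), mul_comm]
    intro M hM
    rw [Finset.card_powerset, (Finset.mem_filter.1 hM).2.1]
  rw [hcount, ← hsigma]
  symm
  refine Finset.card_bij' (fun x _ => x.1.image (orientEdge x.2))
    (fun D _ => ⟨D.image fun p => s(p.1, p.2),
      (D.filter fun p => Quot.out s(p.1, p.2) = p).image fun p => s(p.1, p.2)⟩) ?_ ?_ ?_ ?_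
  · rintro ⟨M, T⟩ h
    obtain ⟨⟨hc, he, hd⟩, -⟩ : (M.card = m ∧ (∀ e ∈ M, e ∈ (⊤ : SimpleGraph V).edgeSet) ∧
        ∀ e ∈ M, ∀ f ∈ M, e ≠ f → ∀ v : V, v ∈ e → v ∉ f) ∧ T ⊆ M := by
      simpa [hA] using h
    have hmem : ∀ (e : Sym2 V) (v : V),
        v ∈ e ↔ v = (orientEdge T e).1 ∨ v = (orientEdge T e).2 := fun e v => by
      rw [← Sym2.mem_iff, mk_orientEdge]
    have hinj : Function.Injective (orientEdge T) := fun e f hef => by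
      rw [← mk_orientEdge T e, hef, mk_orientEdge]
    simp only [Finset.mem_filter, Finset.mem_univ, true_and]
    refine ⟨by rw [Finset.card_image_of_injective _ hinj, hc], ?_, ?_⟩
    · intro p hp
      obtain ⟨e, heM, rfl⟩ := Finset.mem_image.1 hp
      have := he e heM
      rw [← mk_orientEdge T e, SimpleGraph.mem_edgeSet] at this
      exact this
    · intro p hp q hq hpq
      obtain ⟨e, heM, rfl⟩ := Finset.mem_image.1 hp
      obtain ⟨f, hfM, rfl⟩ := Finset.mem_image.1 hq
      have hef : e ≠ f := fun h => hpq (h ▸ rfl)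
      have h0 := hd e heM f hfM hef
      have h1 := h0 _ ((hmem e _).2 (Or.inl rfl))
      have h2 := h0 _ ((hmem e _).2 (Or.inr rfl))
      rw [hmem f] at h1 h2
      tauto
  · intro D h
    obtain ⟨hc, hD⟩ := (Finset.mem_filter.1 h).2
    have hsub : ((D.filter fun p => Quot.out s(p.1, p.2) = p).image fun p => s(p.1, p.2)) ⊆
        D.image fun p => s(p.1, p.2) := Finset.image_subset_image (Finset.filter_subset _ _)
    simp only [hA, Finset.mem_sigma, Finset.mem_filter, Finset.mem_univ, true_and,
      Finset.mem_powerset]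
    refine ⟨⟨?_, ?_, ?_⟩, hsub⟩
    · rw [Finset.card_image_of_injOn hD.injOn_mk, hc]
    · intro e he
      obtain ⟨p, hp, rfl⟩ := Finset.mem_image.1 he
      exact hD.1 p hp
    · intro e he f hf hef v hve hvf
      obtain ⟨p, hp, rfl⟩ := Finset.mem_image.1 he
      obtain ⟨q, hq, rfl⟩ := Finset.mem_image.1 hf
      have hpq : p ≠ q := fun h => hef (h ▸ rfl)
      have := hD.2 p hp q hq hpq
      rw [Sym2.mem_iff] at hve hvf
      grind
  · rintro ⟨M, T⟩ h
    have hTM : T ⊆ M := by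
      simpa using (Finset.mem_sigma.1 h).2
    have hM : ∀ e ∈ M, ¬ e.IsDiag := by
      intro e he
      have := (Finset.mem_filter.1 (Finset.mem_sigma.1 h).1).2.2.1 e he
      simpa using this
    have hout : ∀ e ∈ M, (Quot.out e = orientEdge T e ↔ e ∈ T) := by
      intro e he
      unfold orientEdge
      split_ifs with hT
      · simp [hT]
      · simp only [hT, iff_false]
        intro hs
        have h1 : (Quot.out e).1 = (Quot.out e).2 := congrArg Prod.fst hs
        have h' : Sym2.mk (Quot.out e).1 (Quot.out e).2 = e := Quot.out_eq e
        apply hM e he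
        rw [← h']
        exact h1
    have h1 : ((M.image (orientEdge T)).image fun p => s(p.1, p.2)) = M := by
      rw [Finset.image_image]
      exact (Finset.image_congr fun e _ => mk_orientEdge T e).trans Finset.image_id
    have h2 : (((M.image (orientEdge T)).filter fun p => Quot.out s(p.1, p.2) = p).image
        fun p => s(p.1, p.2)) = T := by
      ext e
      simp only [Finset.mem_image, Finset.mem_filter]
      constructor
      · rintro ⟨p, ⟨⟨f, hf, rfl⟩, hp⟩, rfl⟩
        rw [mk_orientEdge] at hp ⊢
        exact (hout f hf).1 hp
      · intro he
        refine ⟨orientEdge T e, ⟨⟨e, hTM he, rfl⟩, ?_⟩, mk_orientEdge T e⟩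
        rw [mk_orientEdge]
        exact (hout e (hTM he)).2 he
    simp only [h1, h2]
  · intro D h
    obtain ⟨hc, hD⟩ := (Finset.mem_filter.1 h).2
    have key : ∀ p ∈ D, orientEdge ((D.filter fun p => Quot.out s(p.1, p.2) = p).image
        fun p => s(p.1, p.2)) s(p.1, p.2) = p := by
      intro p hp
      apply orientEdge_mk
      simp only [Finset.mem_image, Finset.mem_filter]
      constructor
      · rintro ⟨q, ⟨hq, hq'⟩, hqp⟩
        have := hD.injOn_mk hq hp hqp
        rwa [this] at hq'
      · intro h'
        exact ⟨p, ⟨hp, h'⟩, rfl⟩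
    simp only [Finset.image_image]
    ext p
    simp only [Finset.mem_image, Function.comp]
    constructor
    · rintro ⟨q, hq, rfl⟩
      rwa [key q hq]
    · intro hp
      exact ⟨p, hp, key p hp⟩

open Classical in
theorem card_perm_fixing {V : Type*} [Fintype V] (A : Finset V) :
    (Finset.univ.filter fun σ : Equiv.Perm V => ∀ a ∈ A, σ a = a).card =
      (Fintype.card V - A.card).factorial := by
  have h := Fintype.card_congr (Equiv.Perm.subtypeEquivSubtypePerm fun a : V => a ∉ A)
  rw [Fintype.card_perm, Fintype.card_subtype, Fintype.card_subtype] at h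
  simp only [not_not] at h
  rw [← h, ← Finset.card_compl]
  congr 2
  ext a
  simp

open Classical in
theorem IsOrientedMatching.card_perm_extending {V : Type*} [Fintype V] {D : Finset (V × V)}
    (hD : IsOrientedMatching D) :
    (Finset.univ.filter fun σ : Equiv.Perm V => ∀ p ∈ D, σ p.1 = p.2).card =
      (Fintype.card V - D.card).factorial := by
  have hfst : Set.InjOn (Prod.fst : V × V → V) D := fun p hp q hq h => by
    by_contra hpq
    exact (hD.2 p hp q hq hpq).1 h
  have hf : ∀ a : V, ∃ b, ∀ p ∈ D, p.1 = a → p.2 = b := by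
    intro a
    by_cases ha : ∃ p ∈ D, p.1 = a
    · obtain ⟨p, hp, rfl⟩ := ha
      exact ⟨p.2, fun q hq h => by rw [hfst hq hp h]⟩
    · exact ⟨a, fun p hp h => absurd ⟨p, hp, h⟩ ha⟩
  choose f hf using hf
  have hfD : ∀ p ∈ D, f p.1 = p.2 := fun p hp => (hf p.1 p hp rfl).symm
  have hinj : Set.InjOn f (D.image Prod.fst : Finset V) := by
    intro a ha b hb hab
    obtain ⟨p, hp, rfl⟩ := Finset.mem_image.1 ha
    obtain ⟨q, hq, rfl⟩ := Finset.mem_image.1 hb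
    rw [hfD p hp, hfD q hq] at hab
    by_contra hpq
    exact (hD.2 p hp q hq fun h => hpq (h ▸ rfl)).2.2.2 hab
  obtain ⟨g, hg⟩ := Finset.exists_equiv_extend_of_card_eq (t := (Finset.univ : Finset V))
    Finset.card_univ.symm (Finset.subset_univ _) hinj
  let τ : Equiv.Perm V := g.trans (Equiv.subtypeUnivEquiv Finset.mem_univ)
  have hτ : ∀ p ∈ D, τ p.1 = p.2 := fun p hp =>
    (hg p.1 (Finset.mem_image_of_mem _ hp)).trans (hfD p hp)
  rw [← Finset.card_image_of_injOn hfst, ← card_perm_fixing]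
  refine Finset.card_bij' (fun σ _ => τ⁻¹ * σ) (fun σ _ => τ * σ) ?_ ?_ ?_ ?_
  · intro σ hσ
    simp only [Finset.mem_filter, Finset.mem_univ, true_and] at hσ ⊢
    intro a ha
    obtain ⟨p, hp, rfl⟩ := Finset.mem_image.1 ha
    rw [Equiv.Perm.mul_apply, hσ p hp, Equiv.Perm.inv_eq_iff_eq, hτ p hp]
  · intro σ hσ
    simp only [Finset.mem_filter, Finset.mem_univ, true_and] at hσ ⊢
    intro p hp
    rw [Equiv.Perm.mul_apply, hσ p.1 (Finset.mem_image_of_mem _ hp), hτ p hp]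
  · intro σ _
    simp
  · intro σ _
    simp

open Classical in
theorem permMatchingCount_eq {d : ℕ} (σ : Equiv.Perm (Fin d)) (m : ℕ) :
    permMatchingCount σ m =
      ((Finset.univ.filter fun D : Finset (Fin d × Fin d) =>
        D.card = m ∧ IsOrientedMatching D).filter fun D => ∀ p ∈ D, σ p.1 = p.2).card := by
  rw [permMatchingCount, Nat.card_eq_fintype_card, Fintype.card_subtype]
  have hinj : Function.Injective fun s => (s, σ s) := fun s t h => congrArg Prod.fst h
  refine Finset.card_bij' (fun S _ => S.image fun s => (s, σ s))
    (fun D _ => D.image Prod.fst) ?_ ?_ ?_ ?_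
  · intro S hS
    simp only [Finset.mem_filter, Finset.mem_univ, true_and] at hS ⊢
    obtain ⟨hc, hfix, hdis⟩ := hS
    refine ⟨⟨by rw [Finset.card_image_of_injective _ hinj, hc], ?_, ?_⟩, ?_⟩
    · intro p hp
      obtain ⟨s, hs, rfl⟩ := Finset.mem_image.1 hp
      exact (hfix s hs).symm
    · intro p hp q hq hpq
      obtain ⟨s, hs, rfl⟩ := Finset.mem_image.1 hp
      obtain ⟨t, ht, rfl⟩ := Finset.mem_image.1 hq
      have h := hdis s hs t ht fun h => hpq (h ▸ rfl)
      rw [← Finset.disjoint_iff_inter_eq_empty] at h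
      simp at h
      grind
    · intro p hp
      obtain ⟨s, hs, rfl⟩ := Finset.mem_image.1 hp
      rfl
  · intro D hD
    simp only [Finset.mem_filter, Finset.mem_univ, true_and] at hD ⊢
    obtain ⟨⟨hc, hD⟩, hσ⟩ := hD
    refine ⟨?_, ?_, ?_⟩
    · rw [Finset.card_image_of_injOn, hc]
      intro p hp q hq h
      by_contra hpq
      exact (hD.2 p hp q hq hpq).1 h
    · intro s hs
      obtain ⟨p, hp, rfl⟩ := Finset.mem_image.1 hs
      rw [hσ p hp]
      exact (hD.1 p hp).symm
    · intro s hs t ht hst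
      obtain ⟨p, hp, rfl⟩ := Finset.mem_image.1 hs
      obtain ⟨q, hq, rfl⟩ := Finset.mem_image.1 ht
      have h := hD.2 p hp q hq fun h => hst (h ▸ rfl)
      rw [hσ p hp, hσ q hq, ← Finset.disjoint_iff_inter_eq_empty]
      simp
      grind
  · intro S _
    simp only [Finset.image_image]
    exact Finset.image_id
  · intro D hD
    have hσ := (Finset.mem_filter.1 hD).2
    rw [Finset.image_image]
    conv_rhs => rw [← Finset.image_id (s := D)]
    refine Finset.image_congr fun p hp => ?_
    exact Prod.ext rfl (hσ p hp)

/-- `2^m · (d−m)! · a(K_d, m) = Σ_{σ ∈ S_d} a(G_σ, m)`. -/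
theorem completeMatchingCount_vs_permMatchingCount (d m : ℕ) (hd : 1 ≤ d) (hm : 2 * m ≤ d) :
    2 ^ m * (d - m).factorial * matchingCount (⊤ : SimpleGraph (Fin d)) m =
      ∑ σ : Equiv.Perm (Fin d), permMatchingCount σ m := by
  classical
  set O := Finset.univ.filter fun D : Finset (Fin d × Fin d) => D.card = m ∧ IsOrientedMatching D
    with hO
  have hswap : ∑ σ : Equiv.Perm (Fin d), permMatchingCount σ m =
      ∑ D ∈ O, (Finset.univ.filter fun σ : Equiv.Perm (Fin d) => ∀ p ∈ D, σ p.1 = p.2).card := by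
    refine Eq.trans ?_ (Finset.sum_card_bipartiteAbove_eq_sum_card_bipartiteBelow
      (fun (σ : Equiv.Perm (Fin d)) (D : Finset (Fin d × Fin d)) => ∀ p ∈ D, σ p.1 = p.2))
    refine Finset.sum_congr rfl fun σ _ => ?_
    rw [permMatchingCount_eq]
    simp only [hO, Finset.bipartiteAbove]
  have hcard : O.card = 2 ^ m * matchingCount (⊤ : SimpleGraph (Fin d)) m := by
    rw [← card_orientedMatching]
  rw [hswap, Finset.sum_const_nat (m := (d - m).factorial), mul_right_comm, hcard]
  intro D hD
  obtain ⟨hc, hD⟩ := (Finset.mem_filter.1 hD).2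
  have h := hD.card_perm_extending
  rw [hc, Fintype.card_fin] at h
  rw [← h]
  congr!

end
end

section
/- Let n ≥ 3 and d ≥ 1 be integers, let λ, μ : ℤ/nℤ → S_d, fix i₀ ∈ ℤ/nℤ and set ℓ₀ = i₀ + 1. Suppose that λ(i) = μ(i) for every i ∉ {i₀, ℓ₀}, and that the composites agree in the order 'first λ(i₀), then λ(ℓ₀)': λ(ℓ₀) ∘ λ(i₀) = μ(ℓ₀) ∘ μ(i₀). Then the cover graphs C_{n,λ} and C_{n,μ} are isomorphic as simple graphs. -/
open Polynomial


noncomputable section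

/-- A gauge transformation `g` carrying the labeling `lam` to `mu` induces an isomorphism of the
corresponding covers. -/
def coverGraphIsoOfGauge {n d : ℕ} {lam mu : ZMod n → Equiv.Perm (Fin d)}
    (g : ZMod n → Equiv.Perm (Fin d)) (hg : ∀ i, mu i * g i = g (i + 1) * lam i) :
    coverGraph n d lam ≃g coverGraph n d mu where
  toEquiv := Equiv.prodShear (Equiv.refl _) g
  map_rel_iff' := by
    have key (p q : ZMod n × Fin d) :
        (q.1 = p.1 + 1 ∧ g q.1 q.2 = mu p.1 (g p.1 p.2)) ↔
          (q.1 = p.1 + 1 ∧ q.2 = lam p.1 p.2) := by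
      refine and_congr_right fun h => ?_
      rw [h, ← Equiv.Perm.mul_apply, hg, Equiv.Perm.mul_apply, (g _).injective.eq_iff]
    intro p q
    rw [coverGraph, coverGraph, SimpleGraph.fromRel_adj, SimpleGraph.fromRel_adj, ← key p q,
      ← key q p, (Equiv.injective _).ne_iff]
    rfl

/-- Local modification of a labeling at two consecutive edges preserves the cover
up to isomorphism. -/
theorem coverGraph_iso_of_local_change (n d : ℕ) (hn : 3 ≤ n) (hd : 1 ≤ d)
    (lam mu : ZMod n → Equiv.Perm (Fin d)) (i₀ : ZMod n)
    (h1 : ∀ i : ZMod n, i ≠ i₀ → i ≠ i₀ + 1 → lam i = mu i)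
    (h2 : lam (i₀ + 1) * lam i₀ = mu (i₀ + 1) * mu i₀) :
    Nonempty (coverGraph n d lam ≃g coverGraph n d mu) := by
  have : Fact (1 < n) := ⟨by omega⟩
  have hne (i : ZMod n) : i + 1 ≠ i := by simp
  refine ⟨coverGraphIsoOfGauge (Function.update 1 (i₀ + 1) (mu i₀ * (lam i₀)⁻¹)) fun i => ?_⟩
  by_cases hi : i = i₀
  · subst hi
    simp [(hne i).symm]
  by_cases hi' : i = i₀ + 1
  · subst hi'
    rw [Function.update_self, Function.update_of_ne (hne _), ← mul_assoc, ← h2]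
    simp
  · rw [Function.update_of_ne hi', Function.update_of_ne (by simpa using hi), h1 i hi hi']
    simp

end
end

section
/- Let n ≥ 3 and d ≥ 1 be integers and let λ, μ : ℤ/nℤ → S_d. If the full products taken around the cycle agree, i.e. λ(n−1) ∘ λ(n−2) ∘ ⋯ ∘ λ(1) ∘ λ(0) = μ(n−1) ∘ μ(n−2) ∘ ⋯ ∘ μ(1) ∘ μ(0) (applying λ(0) first), then the cover graphs C_{n,λ} and C_{n,μ} are isomorphic as simple graphs. -/
open Polynomial


noncomputable section

/-- The product `λ(k-1) ∘ ⋯ ∘ λ(0)` of the first `k` labels. -/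
def partialProd (n d : ℕ) (lam : ZMod n → Equiv.Perm (Fin d)) (k : ℕ) : Equiv.Perm (Fin d) :=
  (((List.range k).map fun i => lam (i : ZMod n)).reverse).prod

theorem partialProd_zero (n d : ℕ) (lam : ZMod n → Equiv.Perm (Fin d)) :
    partialProd n d lam 0 = 1 := by
  simp [partialProd]

theorem partialProd_succ (n d : ℕ) (lam : ZMod n → Equiv.Perm (Fin d)) (k : ℕ) :
    partialProd n d lam (k + 1) = lam (k : ZMod n) * partialProd n d lam k := by
  simp [partialProd, List.range_succ]

/-- Labelings related by a change of coordinates in the fibers have isomorphic covers. -/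
theorem coverGraph_iso_of_gauge (n d : ℕ) (lam mu g : ZMod n → Equiv.Perm (Fin d))
    (hg : ∀ i, g (i + 1) * lam i = mu i * g i) :
    Nonempty (coverGraph n d lam ≃g coverGraph n d mu) := by
  have key (i : ZMod n) (x y : Fin d) : g (i + 1) y = mu i (g i x) ↔ y = lam i x := by
    rw [← Equiv.Perm.mul_apply, ← hg, Equiv.Perm.mul_apply, (g (i + 1)).apply_eq_iff_eq]
  have rel (i j : ZMod n) (x y : Fin d) :
      (j = i + 1 ∧ g j y = mu i (g i x)) ↔ (j = i + 1 ∧ y = lam i x) :=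
    and_congr_right fun hj => by subst hj; exact key i x y
  refine ⟨⟨Equiv.prodShear (Equiv.refl _) g, ?_⟩⟩
  rintro ⟨i, x⟩ ⟨j, y⟩
  rw [coverGraph, coverGraph, SimpleGraph.fromRel_adj, SimpleGraph.fromRel_adj,
    (Equiv.injective _).ne_iff]
  simp only [Equiv.prodShear_apply, Equiv.refl_apply, rel]

/-- When the products around the cycle agree, the quotients of partial products carry `lam` to
`mu`. -/
theorem gauge_of_cycleProd_eq (n d : ℕ) [NeZero n] (lam mu : ZMod n → Equiv.Perm (Fin d))
    (h : cycleProd n d lam = cycleProd n d mu) (i : ZMod n) :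
    (partialProd n d mu (i + 1).val * (partialProd n d lam (i + 1).val)⁻¹) * lam i =
      mu i * (partialProd n d mu i.val * (partialProd n d lam i.val)⁻¹) := by
  have hsucc (nu : ZMod n → Equiv.Perm (Fin d)) :
      partialProd n d nu (i.val + 1) = nu i * partialProd n d nu i.val := by
    rw [partialProd_succ, ZMod.natCast_zmod_val]
  have hval : partialProd n d mu (i + 1).val * (partialProd n d lam (i + 1).val)⁻¹ =
      partialProd n d mu (i.val + 1) * (partialProd n d lam (i.val + 1))⁻¹ := by
    have hi : ((i.val + 1 : ℕ) : ZMod n) = i + 1 := by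
      rw [Nat.cast_add, ZMod.natCast_zmod_val, Nat.cast_one]
    rw [← hi, ZMod.val_natCast]
    rcases (Nat.succ_le_of_lt i.val_lt).lt_or_eq with hlt | heq
    · rw [Nat.mod_eq_of_lt hlt]
    · have hn : partialProd n d lam n = partialProd n d mu n := h
      rw [show i.val + 1 = n from heq, Nat.mod_self, hn, partialProd_zero, partialProd_zero]
      simp
  rw [hval, hsucc, hsucc]
  group

/-- If the products of the labels around the cycle agree, the covers are isomorphic. -/
theorem coverGraph_iso_of_cycleProd_eq (n d : ℕ) (hn : 3 ≤ n) (hd : 1 ≤ d)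
    (lam mu : ZMod n → Equiv.Perm (Fin d))
    (h : cycleProd n d lam = cycleProd n d mu) :
    Nonempty (coverGraph n d lam ≃g coverGraph n d mu) := by
  have : NeZero n := ⟨by omega⟩
  exact coverGraph_iso_of_gauge n d lam mu
    (fun i => partialProd n d mu i.val * (partialProd n d lam i.val)⁻¹)
    (gauge_of_cycleProd_eq n d lam mu h)

end
end

section
/- Let n ≥ 3 and d ≥ 1 be integers and let λ, μ : ℤ/nℤ → S_d. If there exists g ∈ S_d with g⁻¹ · (λ(n−1) ∘ ⋯ ∘ λ(0)) · g = μ(n−1) ∘ ⋯ ∘ μ(0) (products applying λ(0), resp. μ(0), first), i.e. the products around the cycle are conjugate in S_d, then the cover graphs C_{n,λ} and C_{n,μ} are isomorphic as simple graphs. -/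
open Polynomial


noncomputable section

/-- The product `λ(k-1) ∘ ⋯ ∘ λ(0)` of the first `k` labels (applying `λ(0)` first). -/
def initialProd (n d : ℕ) (lam : ZMod n → Equiv.Perm (Fin d)) (k : ℕ) : Equiv.Perm (Fin d) :=
  (((List.range k).map fun i => lam (i : ZMod n)).reverse).prod

@[simp]
theorem initialProd_zero (n d : ℕ) (lam : ZMod n → Equiv.Perm (Fin d)) :
    initialProd n d lam 0 = 1 := by
  simp [initialProd]

theorem initialProd_succ (n d : ℕ) (lam : ZMod n → Equiv.Perm (Fin d)) (k : ℕ) :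
    initialProd n d lam (k + 1) = lam k * initialProd n d lam k := by
  simp [initialProd, List.range_succ]

/-- Gauge-equivalent labelings have isomorphic covers. -/
theorem nonempty_coverGraph_iso_of_gauge {n d : ℕ} {lam mu : ZMod n → Equiv.Perm (Fin d)}
    (c : ZMod n → Equiv.Perm (Fin d)) (hc : ∀ i, c (i + 1) * lam i = mu i * c i) :
    Nonempty (coverGraph n d lam ≃g coverGraph n d mu) := by
  have key : ∀ (i : ZMod n) (x y : Fin d),
      c (i + 1) y = mu i (c i x) ↔ y = lam i x := fun i x y => by
    rw [← Equiv.Perm.mul_apply (mu i), ← hc, Equiv.Perm.mul_apply, (c (i + 1)).apply_eq_iff_eq]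
  have rel : ∀ p q : ZMod n × Fin d,
      (q.1 = p.1 + 1 ∧ c q.1 q.2 = mu p.1 (c p.1 p.2)) ↔
        (q.1 = p.1 + 1 ∧ q.2 = lam p.1 p.2) := fun p q =>
    and_congr_right fun h => by rw [h, key]
  let e : ZMod n × Fin d ≃ ZMod n × Fin d := Equiv.prodShear (Equiv.refl _) c
  refine ⟨⟨e, fun {p q} => ?_⟩⟩
  simp only [coverGraph, SimpleGraph.fromRel_adj, e.injective.ne_iff]
  exact and_congr_right fun _ => or_congr (rel p q) (rel q p)

/-- If the products around the cycle are conjugate in `S_d`, the covers are isomorphic. -/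
theorem coverGraph_iso_of_cycleProd_isConj (n d : ℕ) (hn : 3 ≤ n) (hd : 1 ≤ d)
    (lam mu : ZMod n → Equiv.Perm (Fin d))
    (h : ∃ g : Equiv.Perm (Fin d), g⁻¹ * cycleProd n d lam * g = cycleProd n d mu) :
    Nonempty (coverGraph n d lam ≃g coverGraph n d mu) := by
  obtain ⟨g, hg⟩ := h
  have : NeZero n := ⟨by omega⟩
  refine nonempty_coverGraph_iso_of_gauge
    (fun i => initialProd n d mu i.val * g⁻¹ * (initialProd n d lam i.val)⁻¹) fun i => ?_
  have hi : ((i.val : ℕ) : ZMod n) = i := ZMod.natCast_zmod_val i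
  have hlam := initialProd_succ n d lam i.val
  have hmu := initialProd_succ n d mu i.val
  rw [hi] at hlam hmu
  have hsucc : i + 1 = ((i.val + 1 : ℕ) : ZMod n) := by rw [Nat.cast_succ, hi]
  rcases (Nat.succ_le_of_lt i.val_lt).lt_or_eq with hlt | heq
  · have hval : (i + 1).val = i.val + 1 := by rw [hsucc, ZMod.val_cast_of_lt hlt]
    simp only [hval, hlam, hmu]
    group
  · have hzero : i + 1 = 0 := by rw [hsucc, ← Nat.succ_eq_add_one, heq, ZMod.natCast_self]
    have hg' : g⁻¹ * initialProd n d lam (i.val + 1) * g = initialProd n d mu (i.val + 1) := by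
      rw [← Nat.succ_eq_add_one, heq]
      exact hg
    rw [hlam, hmu] at hg'
    simp only [hzero, ZMod.val_zero, initialProd_zero]
    rw [← mul_assoc, ← mul_assoc, ← hg']
    group

end
end

section
/- Let n ≥ 3 and d ≥ 1 be integers, let λ : ℤ/nℤ → S_d, and let σ = λ(n−1) ∘ ⋯ ∘ λ(0) ∈ S_d (applying λ(0) first), with cycle type (μ_1, …, μ_d), where μ_i is the number of cycles of length i (fixed points counted as 1-cycles) in the disjoint cycle decomposition of σ. Then the cover graph C_{n,λ} is isomorphic to the disjoint union, over i = 1, …, d, of μ_i copies of the cycle graph C_{n·i}; consequently its matching polynomial satisfies M_{C_{n,λ}}(x) = Π_{i=1}^{d} (𝒞_{n·i}(x))^{μ_i}. -/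
open Polynomial


noncomputable section

/-- The disjoint union, over `i = 1, …, d`, of `μ_i(σ)` copies of the cycle graph on
`n·i` vertices. -/
def cyclesDisjointUnion (n d : ℕ) (σ : Equiv.Perm (Fin d)) :
    SimpleGraph (Σ i : Fin d, Fin (cycleCount σ (i.1 + 1)) × ZMod (n * (i.1 + 1))) :=
  SimpleGraph.fromRel fun p q => q = ⟨p.1, (p.2.1, p.2.2 + 1)⟩

open Function

section Trace

variable {R ι : Type*} [CommRing R] [Fintype ι] [DecidableEq ι]

theorem Matrix.sum_path_prod (T : Matrix ι ι R) (m : ℕ) (g : ι → ι → R) :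
    ∑ f : Fin (m + 1) → ι, g (f 0) (f (Fin.last m)) * ∏ i : Fin m, T (f i.castSucc) (f i.succ) =
      ∑ a, ∑ b, g a b * (T ^ m) a b := by
  induction m generalizing g with
  | zero =>
    rw [← (Equiv.funUnique (Fin 1) ι).symm.sum_comp]
    simp [Matrix.one_apply, Equiv.funUnique]
  | succ m ih =>
    rw [← (Fin.consEquiv fun _ => ι).sum_comp, Fintype.sum_prod_type]
    refine Finset.sum_congr rfl fun a _ => ?_
    have key := ih fun c b => g a b * T a c
    calc _ = ∑ f : Fin (m + 1) → ι, g a (f (Fin.last m)) * T a (f 0) *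
            ∏ i : Fin m, T (f i.castSucc) (f i.succ) := by
          refine Finset.sum_congr rfl fun f _ => ?_
          rw [Fin.prod_univ_succ]
          simp [Fin.consEquiv, ← Fin.succ_last, mul_assoc]
      _ = _ := by
          rw [key, Finset.sum_comm]
          refine Finset.sum_congr rfl fun b _ => ?_
          rw [pow_succ', Matrix.mul_apply, Finset.mul_sum]
          exact Finset.sum_congr rfl fun c _ => by ring

theorem Matrix.sum_cycle_prod (T : Matrix ι ι R) (m : ℕ) [NeZero m] :
    ∑ f : ZMod m → ι, ∏ t, T (f t) (f (t + 1)) = (T ^ m).trace := by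
  obtain ⟨k, rfl⟩ := Nat.exists_eq_succ_of_ne_zero (NeZero.ne m)
  have h := Matrix.sum_path_prod T k fun a b => T b a
  rw [Matrix.trace]
  calc _ = ∑ f : Fin (k + 1) → ι, T (f (Fin.last k)) (f 0) *
          ∏ i : Fin k, T (f i.castSucc) (f i.succ) := by
        refine Finset.sum_congr rfl fun f _ => ?_
        let f' : Fin (k + 1) → ι := f
        refine (Fin.prod_univ_castSucc fun t : Fin (k + 1) => T (f' t) (f' (t + 1))).trans ?_
        rw [mul_comm, Fin.last_add_one]
        simp only [Fin.coeSucc_eq_succ]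
        rfl
    _ = _ := by
        rw [h, Finset.sum_comm]
        refine Finset.sum_congr rfl fun b _ => ?_
        rw [pow_succ', Matrix.diag_apply, Matrix.mul_apply]

end Trace

/-- Transfer matrix of the matching polynomial along a cycle: the state `1` at a vertex means
that the edge leaving it is in the matching. -/
def matchingTransfer : Matrix (Fin 2) (Fin 2) ℚ[X] := !![X, -1; 1, 0]

theorem trace_matchingTransfer_pow (m : ℕ) : (matchingTransfer ^ m).trace = cyclePoly m := by
  have hsq : matchingTransfer ^ 2 = (X : ℚ[X]) • matchingTransfer - 1 := by
    ext i j : 2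
    fin_cases i <;> fin_cases j <;> simp [matchingTransfer, sq, sub_eq_add_neg]
  induction m using Nat.twoStepInduction with
  | zero => simp [cyclePoly]
  | one => simp [cyclePoly, matchingTransfer, Matrix.trace_fin_two]
  | more m h0 h1 =>
    rw [pow_add, hsq, mul_sub, mul_one, Matrix.mul_smul, ← pow_succ, Matrix.trace_sub,
      Matrix.trace_smul, h0, h1, cyclePoly, smul_eq_mul]

/-- The graph joining every `v` to `F v`. -/
def permGraph {V : Type*} (F : Equiv.Perm V) : SimpleGraph V :=
  SimpleGraph.fromRel fun p q => q = F p

theorem permGraph_edgeSet {V : Type*} {F : Equiv.Perm V} (hF : ∀ v, F v ≠ v) :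
    (permGraph F).edgeSet = Set.range fun v => s(v, F v) := by
  ext e
  induction e with | _ a b => ?_
  simp only [SimpleGraph.mem_edgeSet, permGraph, SimpleGraph.fromRel_adj, Set.mem_range, Sym2.eq_iff]
  constructor
  · rintro ⟨-, rfl | rfl⟩
    · exact ⟨a, by simp⟩
    · exact ⟨b, by simp⟩
  · rintro ⟨v, ⟨rfl, rfl⟩ | ⟨rfl, rfl⟩⟩
    · exact ⟨(hF _).symm, by simp⟩
    · exact ⟨hF _, by simp⟩

section Matching

variable {V : Type*} [Fintype V] [DecidableEq V]

theorem matchingCount_permGraph {F : Equiv.Perm V} (hF : ∀ v, F v ≠ v) (hF2 : ∀ v, F (F v) ≠ v)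
    (m : ℕ) :
    matchingCount (permGraph F) m =
      (Finset.univ.filter fun S : Finset V => (∀ v ∈ S, F v ∉ S) ∧ S.card = m).card := by
  have hinj : Injective fun v => s(v, F v) := by
    intro v w h
    rcases Sym2.eq_iff.1 h with h | ⟨h1, h2⟩
    · exact h.1
    · exact absurd (h2 ▸ h1.symm) (h1 ▸ hF2 v)
  have hmem : ∀ (S : Finset V) v, s(v, F v) ∈ S.map ⟨_, hinj⟩ ↔ v ∈ S := fun S v =>
    Finset.mem_map' ⟨_, hinj⟩
  rw [← Fintype.card_subtype, ← Nat.card_eq_fintype_card]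
  have hmap : ∀ S : Finset V, (∀ v ∈ S, F v ∉ S) ∧ S.card = m →
      (S.map ⟨_, hinj⟩).card = m ∧ (∀ e ∈ S.map ⟨_, hinj⟩, e ∈ (permGraph F).edgeSet) ∧
        ∀ e ∈ S.map ⟨_, hinj⟩, ∀ f ∈ S.map ⟨_, hinj⟩, e ≠ f → ∀ v : V, v ∈ e → v ∉ f := by
    rintro S ⟨hS, hcard⟩
    refine ⟨by rw [Finset.card_map, hcard], fun e he => ?_, fun e he f hf hne u hu hu' => ?_⟩
    · obtain ⟨v, -, rfl⟩ := Finset.mem_map.1 he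
      rw [permGraph_edgeSet hF]
      exact ⟨v, rfl⟩
    · obtain ⟨v, hv, rfl⟩ := Finset.mem_map.1 he
      obtain ⟨w, hw, rfl⟩ := Finset.mem_map.1 hf
      simp only [Embedding.coeFn_mk, Sym2.mem_iff] at hu hu' hne
      rcases hu with rfl | rfl <;> rcases hu' with h | h
      · exact hne (by rw [h])
      · exact hS w hw (h ▸ hv)
      · exact hS v hv (h ▸ hw)
      · exact hne (by rw [F.injective h])
  refine (Nat.card_eq_of_bijective (fun S => ⟨S.1.map ⟨_, hinj⟩, hmap S.1 S.2⟩) ⟨?_, ?_⟩).symm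
  · intro S S' h
    exact Subtype.ext (Finset.map_injective _ (congrArg Subtype.val h))
  · rintro ⟨M, hcard, hsub, hdisj⟩
    have hM : (Finset.univ.filter fun v => s(v, F v) ∈ M).map ⟨_, hinj⟩ = M := by
      ext e
      constructor
      · intro he
        obtain ⟨v, hv, rfl⟩ := Finset.mem_map.1 he
        exact (Finset.mem_filter.1 hv).2
      · intro he
        obtain ⟨v, rfl⟩ := (permGraph_edgeSet hF).subset (hsub e he)
        exact (hmem _ _).2 (by simpa using he)
    refine ⟨⟨Finset.univ.filter fun v => s(v, F v) ∈ M, ?_, ?_⟩, Subtype.ext hM⟩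
    · intro v hv hFv
      exact hdisj _ (Finset.mem_filter.1 hv).2 _ (Finset.mem_filter.1 hFv).2
        (fun h => hF v (hinj h).symm) (F v) (by simp) (by simp)
    · rw [← hcard, ← Finset.card_map ⟨_, hinj⟩, hM]

theorem prod_matchingTransfer (F : Equiv.Perm V) (S : Finset V) :
    ∏ v, matchingTransfer (if v ∈ S then 1 else 0) (if F v ∈ S then 1 else 0) =
      if ∀ v ∈ S, F v ∉ S then (-1) ^ S.card * X ^ (Fintype.card V - 2 * S.card) else 0 := by
  split_ifs with h
  · have hpre : (Finset.univ.filter fun v => F v ∈ S).card = S.card := by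
      rw [← Finset.card_map F.toEmbedding]
      congr 1
      ext v
      simp
    have hcov : (Finset.univ.filter fun v => ¬(v ∈ S ∨ F v ∈ S)).card =
        Fintype.card V - 2 * S.card := by
      rw [Finset.filter_not, Finset.card_sdiff_of_subset (Finset.filter_subset _ _),
        Finset.filter_or, Finset.card_union_of_disjoint, hpre, Finset.card_univ,
        Finset.filter_univ_mem, two_mul]
      rw [Finset.disjoint_filter]
      exact fun v _ => h v
    calc _ = (∏ v, if F v ∈ S then (-1 : ℚ[X]) else 1) *
          ∏ v, if v ∈ S ∨ F v ∈ S then (1 : ℚ[X]) else X := by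
          rw [← Finset.prod_mul_distrib]
          refine Finset.prod_congr rfl fun v _ => ?_
          by_cases h1 : v ∈ S <;> by_cases h2 : F v ∈ S <;> simp [h1, h2, matchingTransfer]
          exact h v h1 h2
      _ = _ := by
          rw [Finset.prod_ite, Finset.prod_ite]
          simp only [Finset.prod_const, one_pow, hpre, hcov, mul_one, one_mul]
  · push Not at h
    obtain ⟨v, hv, hFv⟩ := h
    exact Finset.prod_eq_zero (Finset.mem_univ v) (by simp [hv, hFv, matchingTransfer])

theorem matchingPoly_permGraph {F : Equiv.Perm V} (hF : ∀ v, F v ≠ v) (hF2 : ∀ v, F (F v) ≠ v) :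
    matchingPoly (permGraph F) = ∑ f : V → Fin 2, ∏ v, matchingTransfer (f v) (f (F v)) := by
  have hbij : Bijective fun (S : Finset V) (v : V) => if v ∈ S then (1 : Fin 2) else 0 := by
    constructor
    · intro S S' h
      ext v
      have := congrFun h v
      by_cases h1 : v ∈ S <;> by_cases h2 : v ∈ S' <;> simp_all
    · intro f
      refine ⟨Finset.univ.filter fun v => f v = 1, funext fun v => ?_⟩
      have : f v = 0 ∨ f v = 1 := by omega
      rcases this with h | h <;> simp [h]
  rw [← hbij.sum_comp]
  simp only [prod_matchingTransfer]
  rw [← Finset.sum_filter, matchingPoly, ← Finset.sum_fiberwise_of_maps_to (g := Finset.card)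
    (t := Finset.range (Fintype.card V + 1))
    (fun S _ => Finset.mem_range_succ_iff.2 (Finset.card_le_univ S))]
  refine Finset.sum_congr rfl fun i _ => ?_
  rw [matchingCount_permGraph hF hF2, Finset.filter_filter]
  rw [Finset.sum_congr rfl (g := fun _ => (-1 : ℚ[X]) ^ i * X ^ (Fintype.card V - 2 * i))]
  · simp [mul_comm, mul_left_comm, mul_assoc]
  · intro S hS
    rw [(Finset.mem_filter.1 hS).2.2]

end Matching

/-- The permutation of `Σ o, ZMod (k o)` adding one to the second coordinate. -/
def sigmaShift {O : Type*} (k : O → ℕ) : Equiv.Perm (Σ o, ZMod (k o)) :=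
  Equiv.sigmaCongrRight fun o => Equiv.addRight (1 : ZMod (k o))

theorem sum_prod_sigmaShift {O : Type*} [Fintype O] [DecidableEq O] (k : O → ℕ)
    [∀ o, NeZero (k o)] :
    ∑ f : (Σ o, ZMod (k o)) → Fin 2, ∏ v, matchingTransfer (f v) (f (sigmaShift k v)) =
      ∏ o, cyclePoly (k o) := by
  simp only [← trace_matchingTransfer_pow, ← Matrix.sum_cycle_prod]
  rw [Finset.prod_univ_sum, Fintype.piFinset_univ,
    ← (Equiv.piCurry fun (o : O) (_ : ZMod (k o)) => Fin 2).sum_comp]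
  refine Finset.sum_congr rfl fun f _ => ?_
  rw [Fintype.prod_sigma]
  rfl

section Cover

theorem exists_cycle_representatives {d : ℕ} (σ : Equiv.Perm (Fin d)) :
    ∃ r : (Σ i : Fin d, Fin (cycleCount σ (i.1 + 1))) → Fin d,
      (∀ c, minimalPeriod σ (r c) = c.1.1 + 1) ∧ (∀ c c', σ.SameCycle (r c) (r c') → c = c') ∧
        ∀ j, ∃ c, σ.SameCycle (r c) j := by
  classical
  let Q := Quotient (Equiv.Perm.SameCycle.setoid σ)
  have hper : ∀ x y, σ.SameCycle x y → minimalPeriod σ x = minimalPeriod σ y := by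
    intro x y h
    obtain ⟨t, rfl⟩ := h.exists_nat_pow_eq
    rw [← Equiv.Perm.iterate_eq_pow, minimalPeriod_apply_iterate (σ.injective.mem_periodicPts x)]
  let per : Q → ℕ := Quotient.lift (fun x => minimalPeriod σ x) hper
  have hpos : ∀ x, 0 < minimalPeriod σ x := fun x =>
    minimalPeriod_pos_of_mem_periodicPts (σ.injective.mem_periodicPts x)
  have hfib : ∀ q : Q, (Finset.univ.filter fun x : Fin d => (⟦x⟧ : Q) = q).card = per q := by
    intro q
    induction q using Quotient.inductionOn with | _ x => ?_
    have himg : (Finset.univ.filter fun y : Fin d => (⟦y⟧ : Q) = ⟦x⟧) =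
        (Finset.range (minimalPeriod σ x)).image fun t => σ^[t] x := by
      ext y
      simp only [Finset.mem_filter, Finset.mem_univ, true_and, Finset.mem_image, Finset.mem_range]
      rw [Quotient.eq]
      constructor
      · intro h
        obtain ⟨t, rfl⟩ := (Equiv.Perm.SameCycle.symm h).exists_nat_pow_eq
        exact ⟨t % minimalPeriod σ x, Nat.mod_lt _ (hpos x), by
          rw [iterate_mod_minimalPeriod_eq, Equiv.Perm.iterate_eq_pow]⟩
      · rintro ⟨t, -, rfl⟩
        exact Equiv.Perm.SameCycle.symm ⟨t, by rw [Equiv.Perm.iterate_eq_pow, zpow_natCast]⟩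
    rw [himg, Finset.card_image_of_injOn, Finset.card_range]
    · rfl
    · intro a ha b hb h
      exact iterate_injOn_Iio_minimalPeriod (by simpa using ha) (by simpa using hb) h
  have hcard : ∀ i : ℕ, Fintype.card {q : Q // per q = i + 1} = cycleCount σ (i + 1) := by
    intro i
    have h := Finset.card_eq_sum_card_fiberwise (f := fun x => (⟦x⟧ : Q))
      (s := Finset.univ.filter fun x : Fin d => minimalPeriod σ x = i + 1)
      (t := Finset.univ.filter fun q : Q => per q = i + 1) (fun x hx => by simpa [per] using hx)
    rw [Finset.sum_congr rfl (g := fun _ => i + 1)] at h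
    · rw [cycleCount, h, Finset.sum_const, smul_eq_mul, Nat.mul_div_cancel _ i.succ_pos,
        Fintype.card_subtype]
    · intro q hq
      have hq' := (Finset.mem_filter.1 hq).2
      refine Eq.trans ?_ ((hfib q).trans hq')
      rw [Finset.filter_filter]
      congr 1
      ext x
      simp only [Finset.mem_filter, Finset.mem_univ, true_and, and_iff_right_iff_imp]
      rintro rfl
      exact hq'
  let e : ∀ i : ℕ, Fin (cycleCount σ (i + 1)) ≃ {q : Q // per q = i + 1} := fun i =>
    (Fintype.equivFinOfCardEq (hcard i)).symm
  have hout : ∀ q : Q, minimalPeriod σ q.out = per q := by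
    intro q
    conv_rhs => rw [← q.out_eq]
    rfl
  refine ⟨fun c => (e c.1 c.2).1.out, fun c => ?_, fun c c' h => ?_, fun j => ?_⟩
  · rw [hout, (e c.1 c.2).2]
  · obtain ⟨i, a⟩ := c
    obtain ⟨i', a'⟩ := c'
    have hq : (e i a).1 = (e i' a').1 := by
      rw [← (e i a).1.out_eq, ← (e i' a').1.out_eq]
      exact Quotient.sound h
    have hi : i = i' := by
      have h1 := (e i a).2
      have h2 := (e i' a').2
      rw [hq] at h1
      omega
    subst hi
    rw [(e i).injective (Subtype.ext hq)]
  · have hj : per ⟦j⟧ ≤ d := by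
      rw [← hfib]
      exact (Finset.card_le_univ _).trans_eq (Fintype.card_fin d)
    have hj0 : 0 < per ⟦j⟧ := hpos j
    refine ⟨⟨⟨per ⟦j⟧ - 1, by omega⟩, (e _).symm ⟨⟦j⟧, by simp only; omega⟩⟩, ?_⟩
    simp only [Equiv.apply_symm_apply]
    exact Quotient.exact (Quotient.out_eq (⟦j⟧ : Q))

variable {n d : ℕ}

/-- The permutation of the vertices of the cover moving one step around the base cycle. -/
def coverStep (lam : ZMod n → Equiv.Perm (Fin d)) : Equiv.Perm (ZMod n × Fin d) :=
  (Equiv.prodShear (Equiv.addRight 1) lam)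

theorem coverStep_apply (lam : ZMod n → Equiv.Perm (Fin d)) (p : ZMod n × Fin d) :
    coverStep lam p = (p.1 + 1, lam p.1 p.2) := rfl

theorem coverGraph_eq_permGraph (lam : ZMod n → Equiv.Perm (Fin d)) :
    coverGraph n d lam = permGraph (coverStep lam) := by
  simp only [coverGraph, permGraph, coverStep_apply, Prod.ext_iff]

theorem coverStep_iterate_fst (lam : ZMod n → Equiv.Perm (Fin d)) (t : ℕ) (p : ZMod n × Fin d) :
    ((coverStep lam)^[t] p).1 = p.1 + t := by
  induction t with
  | zero => simp
  | succ t ih => rw [iterate_succ_apply', coverStep_apply, ih]; push_cast; ring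

theorem coverStep_iterate (lam : ZMod n → Equiv.Perm (Fin d)) (t : ℕ) (j : Fin d) :
    (coverStep lam)^[t] (0, j) =
      ((t : ZMod n), (((List.range t).map fun i => lam (i : ZMod n)).reverse).prod j) := by
  induction t with
  | zero => simp
  | succ t ih => rw [iterate_succ_apply', ih, coverStep_apply]; simp [List.range_succ]

theorem coverStep_iterate_mul (lam : ZMod n → Equiv.Perm (Fin d)) (s : ℕ) (j : Fin d) :
    (coverStep lam)^[n * s] (0, j) = (0, (cycleProd n d lam)^[s] j) := by
  induction s with
  | zero => simp
  | succ s ih =>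
    rw [mul_add_one, add_comm, iterate_add_apply, ih, coverStep_iterate, ZMod.natCast_self,
      iterate_succ_apply', cycleProd]

theorem exists_sigmaShift_equiv [NeZero n] (lam : ZMod n → Equiv.Perm (Fin d)) :
    ∃ e : (Σ c : (Σ i : Fin d, Fin (cycleCount (cycleProd n d lam) (i.1 + 1))),
        ZMod (n * (c.1.1 + 1))) ≃ ZMod n × Fin d,
      ∀ v, e (sigmaShift _ v) = coverStep lam (e v) := by
  set σ := cycleProd n d lam with hσ
  set F := coverStep lam
  obtain ⟨r, hr, hrinj, hrsurj⟩ := exists_cycle_representatives σ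
  let Φ : (Σ c : (Σ i : Fin d, Fin (cycleCount σ (i.1 + 1))), ZMod (n * (c.1.1 + 1))) →
      ZMod n × Fin d := fun v => F^[v.2.val] (0, r v.1)
  have hper : ∀ c, IsPeriodicPt F (n * (c.1.1 + 1)) (0, r c) := by
    intro c
    rw [IsPeriodicPt, IsFixedPt, coverStep_iterate_mul, ← hr c, iterate_minimalPeriod]
  have hle : ∀ v w, v.2.val ≤ w.2.val → Φ v = Φ w → v = w := by
    rintro ⟨c, t⟩ ⟨c', t'⟩ hlt h
    obtain ⟨u, hu⟩ := Nat.exists_eq_add_of_le hlt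
    simp only at hu hlt
    have h1 : ((0 : ZMod n), r c) = F^[u] (0, r c') := by
      apply F.injective.iterate t.val
      rw [← iterate_add_apply, ← hu]
      exact h
    have h2 : n ∣ u := by
      rw [← ZMod.natCast_eq_zero_iff]
      have := coverStep_iterate_fst lam u (0, r c')
      rw [← h1] at this
      simpa using this.symm
    obtain ⟨s, rfl⟩ := h2
    rw [coverStep_iterate_mul] at h1
    have h3 : r c = σ^[s] (r c') := congrArg Prod.snd h1
    obtain rfl : c = c' := (hrinj c' c ⟨s, by rw [zpow_natCast, ← Equiv.Perm.iterate_eq_pow, h3]⟩).symm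
    have h4 : c.1.1 + 1 ∣ s := hr c ▸ IsPeriodicPt.minimalPeriod_dvd h3.symm
    obtain ⟨q, rfl⟩ := h4
    have h5 := ZMod.val_lt t'
    have h6 : q = 0 := by
      by_contra hq
      have : n * (c.1.1 + 1) * 1 ≤ n * (c.1.1 + 1) * q := Nat.mul_le_mul_left _ (by omega)
      rw [hu, ← mul_assoc] at h5
      omega
    subst h6
    have : t = t' := ZMod.val_injective _ (by simpa using hu.symm)
    rw [this]
  have hbij : Bijective Φ := by
    constructor
    · intro v w h
      rcases le_total v.2.val w.2.val with hl | hl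
      · exact hle v w hl h
      · exact (hle w v hl h.symm).symm
    · rintro ⟨k, j⟩
      obtain ⟨j', hj'⟩ : ∃ j', F^[k.val] (0, j') = (k, j) := by
        obtain ⟨⟨k', j'⟩, h⟩ := F.surjective.iterate k.val (k, j)
        have := coverStep_iterate_fst lam k.val (k', j')
        rw [h] at this
        simp only [ZMod.natCast_val, ZMod.cast_id', id_eq, right_eq_add] at this
        exact ⟨j', this ▸ h⟩
      obtain ⟨c, hc⟩ := hrsurj j'
      obtain ⟨s, rfl⟩ := hc.exists_nat_pow_eq
      refine ⟨⟨c, ((k.val + n * s : ℕ) : ZMod _)⟩, ?_⟩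
      simp only [Φ, ZMod.val_natCast]
      rw [(hper c).iterate_mod_apply, iterate_add_apply, coverStep_iterate_mul,
        ← hσ, Equiv.Perm.iterate_eq_pow σ, hj']
  refine ⟨Equiv.ofBijective Φ hbij, ?_⟩
  rintro ⟨c, t⟩
  change F^[(t + 1).val] (0, r c) = F (F^[t.val] (0, r c))
  rw [← iterate_succ_apply' F, ← (hper c).iterate_mod_apply (t.val + 1), ← ZMod.val_natCast]
  simp

end Cover

/-- Conjugate permutations have isomorphic graphs. -/
def permGraphIso {V W : Type*} {F : Equiv.Perm V} {G : Equiv.Perm W} (e : V ≃ W)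
    (h : ∀ v, e (F v) = G (e v)) : permGraph F ≃g permGraph G where
  toEquiv := e
  map_rel_iff' := by
    intro a b
    simp only [permGraph, SimpleGraph.fromRel_adj, ← h, e.injective.eq_iff, ne_eq]

theorem sum_prod_matchingTransfer_congr {V W : Type*} [Fintype V] [Fintype W] [DecidableEq V]
    [DecidableEq W] {F : Equiv.Perm V} {G : Equiv.Perm W} (e : V ≃ W)
    (h : ∀ v, e (F v) = G (e v)) :
    ∑ f : W → Fin 2, ∏ v, matchingTransfer (f v) (f (G v)) =
      ∑ f : V → Fin 2, ∏ v, matchingTransfer (f v) (f (F v)) := by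
  rw [← (e.arrowCongr (Equiv.refl (Fin 2))).sum_comp]
  refine Finset.sum_congr rfl fun f _ => ?_
  rw [← e.prod_comp]
  simp [← h]

/-- The disjoint union of cycles, with the cycles as a single index type. -/
def sigmaCyclesIso (n d : ℕ) (σ : Equiv.Perm (Fin d)) :
    permGraph (sigmaShift fun c : (Σ i : Fin d, Fin (cycleCount σ (i.1 + 1))) =>
      n * (c.1.1 + 1)) ≃g cyclesDisjointUnion n d σ where
  toFun v := ⟨v.1.1, v.1.2, v.2⟩
  invFun v := ⟨⟨v.1, v.2.1⟩, v.2.2⟩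
  left_inv _ := rfl
  right_inv _ := rfl
  map_rel_iff' := by
    rintro ⟨⟨i, a⟩, t⟩ ⟨⟨i', a'⟩, t'⟩
    have hinj : Injective fun v : (Σ c : (Σ i : Fin d, Fin (cycleCount σ (i.1 + 1))),
        ZMod (n * (c.1.1 + 1))) =>
        (⟨v.1.1, v.1.2, v.2⟩ : Σ i : Fin d, Fin (cycleCount σ (i.1 + 1)) × ZMod (n * (i.1 + 1))) :=
      LeftInverse.injective (g := fun v => ⟨⟨v.1, v.2.1⟩, v.2.2⟩) fun _ => rfl
    simp only [permGraph, cyclesDisjointUnion, SimpleGraph.fromRel_adj]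
    refine and_congr hinj.ne_iff (or_congr ?_ ?_)
    · exact hinj.eq_iff (b := sigmaShift _ ⟨⟨i, a⟩, t⟩)
    · exact hinj.eq_iff (b := sigmaShift _ ⟨⟨i', a'⟩, t'⟩)

/-- The cover `C_{n,λ}` is a disjoint union of cycles according to the cycle type of the
product of the labels, and its matching polynomial is the corresponding product. -/
theorem coverGraph_iso_cyclesDisjointUnion (n d : ℕ) [NeZero n] (hn : 3 ≤ n) (hd : 1 ≤ d)
    (lam : ZMod n → Equiv.Perm (Fin d)) :
    Nonempty (coverGraph n d lam ≃g cyclesDisjointUnion n d (cycleProd n d lam)) ∧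
      matchingPoly (coverGraph n d lam) =
        ∏ i ∈ Finset.Icc 1 d, cyclePoly (n * i) ^ cycleCount (cycleProd n d lam) i := by
  obtain ⟨e, he⟩ := exists_sigmaShift_equiv lam
  rw [coverGraph_eq_permGraph]
  refine ⟨⟨(permGraphIso e he).symm.trans (sigmaCyclesIso n d _)⟩, ?_⟩
  have hne : ∀ t : ℕ, 0 < t → t < 3 → ∀ v, (coverStep lam)^[t] v ≠ v := by
    intro t h0 h3 v h
    have h1 := coverStep_iterate_fst lam t v
    rw [h, left_eq_add, ZMod.natCast_eq_zero_iff] at h1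
    have := Nat.le_of_dvd h0 h1
    omega
  rw [matchingPoly_permGraph (hne 1 (by simp) (by simp)) (hne 2 (by simp) (by simp)),
    sum_prod_matchingTransfer_congr e he, sum_prod_sigmaShift, Fintype.prod_sigma]
  simp only [Finset.prod_const, Finset.card_univ, Fintype.card_fin]
  rw [Fin.prod_univ_eq_prod_range (fun i => cyclePoly (n * (i + 1)) ^
    cycleCount (cycleProd n d lam) (i + 1)), Finset.range_eq_Ico,
    Finset.prod_Ico_add' (fun i => cyclePoly (n * i) ^ cycleCount (cycleProd n d lam) i) 0 d 1]
  rfl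

end
end
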